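/- arXiv:math/0606727 — 2 statements merged into one kernel-verified Lean document; each statement's English description precedes it below -/
import Mathlib

section
/- Let D ⊂ ℂ be a bounded open set with C¹ boundary. A continuous function Φ : bD → ℂ extends holomorphically through D if and only if for every function G holomorphic in some open neighbourhood of the closure of D such that Φ + G ≠ 0 at every point of bD, the Brouwer degree of (Φ + G)|bD is nonnegative. -/
open Set Metric Bornology MvPolynomial

noncomputable section

/-- An axiomatization of the Brouwer degree `deg f D y` of a continuous map
`f` on the closure of a bounded open set `D` with respect to a value `y ∉ f (frontier D)`,
via the classical normalization, additivity and homotopy-invariance axioms,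
which determine the degree uniquely. -/
structure BrouwerDegreeTheory (E : Type*) [NormedAddCommGroup E] [NormedSpace ℝ E]
    [FiniteDimensional ℝ E] where
  deg : (E → E) → Set E → E → ℤ
  normalization : ∀ (D : Set E) (y : E), IsOpen D → IsBounded D → y ∈ D → deg id D y = 1
  additivity : ∀ (f : E → E) (D D₁ D₂ : Set E) (y : E), IsOpen D → IsBounded D →
    ContinuousOn f (closure D) → IsOpen D₁ → IsOpen D₂ → D₁ ⊆ D → D₂ ⊆ D →
    Disjoint D₁ D₂ → y ∉ f '' (closure D \ (D₁ ∪ D₂)) →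
    deg f D y = deg f D₁ y + deg f D₂ y
  homotopy_invariance : ∀ (H : ℝ → E → E) (D : Set E) (y : ℝ → E), IsOpen D → IsBounded D →
    ContinuousOn (fun p : ℝ × E => H p.1 p.2) (Icc (0:ℝ) 1 ×ˢ closure D) →
    ContinuousOn y (Icc (0:ℝ) 1) →
    (∀ t ∈ Icc (0:ℝ) 1, ∀ x ∈ frontier D, H t x ≠ y t) →
    deg (H 0) D (y 0) = deg (H 1) D (y 1)

/-- A continuous map on the boundary of `D` extends holomorphically through `D`:
there is a map continuous on the closure of `D`, holomorphic on `D`, agreeing with `Φ`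
on the boundary of `D`. -/
def ExtendsHolomorphically {E F : Type*} [NormedAddCommGroup E] [NormedSpace ℂ E]
    [NormedAddCommGroup F] [NormedSpace ℂ F] (Φ : E → F) (D : Set E) : Prop :=
  ∃ g : E → F, ContinuousOn g (closure D) ∧ DifferentiableOn ℂ g D ∧
    ∀ z ∈ frontier D, g z = Φ z

/-- `D` has `C^k` boundary: near each boundary point there is a `C^k` defining function
with nonvanishing differential. -/
def HasCkBoundary {E : Type*} [NormedAddCommGroup E] [NormedSpace ℝ E]
    (k : ℕ∞) (D : Set E) : Prop :=
  ∀ p ∈ frontier D, ∃ (U : Set E) (ρ : E → ℝ), IsOpen U ∧ p ∈ U ∧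
    ContDiffOn ℝ k ρ U ∧ (∀ x ∈ U, fderiv ℝ ρ x ≠ 0) ∧
    D ∩ U = {x ∈ U | ρ x < 0} ∧ frontier D ∩ U = {x ∈ U | ρ x = 0}

/-- An open set `Ω ⊆ ℂ^N` is Stein iff it is holomorphically convex. -/
def IsStein {E : Type*} [NormedAddCommGroup E] [NormedSpace ℂ E] (Ω : Set E) : Prop :=
  IsOpen Ω ∧ ∀ K ⊆ Ω, IsCompact K →
    IsCompact {z ∈ Ω | ∀ f : E → ℂ, DifferentiableOn ℂ f Ω → ‖f z‖ ≤ ⨆ w : K, ‖f (w : E)‖}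

/-- A compact set has a Stein neighbourhood basis if every neighbourhood of it contains
a Stein open neighbourhood of it. -/
def HasSteinNeighbourhoodBasis {E : Type*} [NormedAddCommGroup E] [NormedSpace ℂ E]
    (K : Set E) : Prop :=
  ∀ U : Set E, IsOpen U → K ⊆ U → ∃ Ω : Set E, IsStein Ω ∧ K ⊆ Ω ∧ Ω ⊆ U

section


namespace BrouwerDegreeTheory
variable (𝒟 : BrouwerDegreeTheory ℂ)

lemma deg_empty (f : ℂ → ℂ) (y : ℂ) : 𝒟.deg f ∅ y = 0 := by
  have := 𝒟.additivity f ∅ ∅ ∅ y isOpen_empty isBounded_empty (by simp) isOpen_empty isOpen_empty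
    (by simp) (by simp) (by simp) (by simp)
  linarith

lemma deg_excision {f : ℂ → ℂ} {D D₁ : Set ℂ} {y : ℂ} (hD : IsOpen D) (hb : IsBounded D)
    (hf : ContinuousOn f (closure D)) (hD₁ : IsOpen D₁) (hs : D₁ ⊆ D)
    (hy : ∀ x ∈ closure D, x ∉ D₁ → f x ≠ y) : 𝒟.deg f D y = 𝒟.deg f D₁ y := by
  have := 𝒟.additivity f D D₁ ∅ y hD hb hf hD₁ isOpen_empty hs (by simp) (by simp)
    (by rintro ⟨x, ⟨hx, hx'⟩, rfl⟩; exact hy x hx (by simpa using hx') rfl)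
  rw [this, deg_empty, add_zero]

lemma deg_add {f : ℂ → ℂ} {D D₁ D₂ : Set ℂ} {y : ℂ} (hD : IsOpen D) (hb : IsBounded D)
    (hf : ContinuousOn f (closure D)) (hD₁ : IsOpen D₁) (hD₂ : IsOpen D₂) (hs₁ : D₁ ⊆ D)
    (hs₂ : D₂ ⊆ D) (hdis : Disjoint D₁ D₂)
    (hy : ∀ x ∈ closure D, x ∉ D₁ → x ∉ D₂ → f x ≠ y) :
    𝒟.deg f D y = 𝒟.deg f D₁ y + 𝒟.deg f D₂ y :=
  𝒟.additivity f D D₁ D₂ y hD hb hf hD₁ hD₂ hs₁ hs₂ hdis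
    (by rintro ⟨x, ⟨hx, hx'⟩, rfl⟩
        simp only [mem_union, not_or] at hx'
        exact hy x hx hx'.1 hx'.2 rfl)

lemma deg_eq_zero {f : ℂ → ℂ} {D : Set ℂ} {y : ℂ} (hD : IsOpen D) (hb : IsBounded D)
    (hf : ContinuousOn f (closure D)) (hy : ∀ x ∈ closure D, f x ≠ y) : 𝒟.deg f D y = 0 := by
  rw [𝒟.deg_excision hD hb hf isOpen_empty (empty_subset _) (fun x hx _ => hy x hx), deg_empty]

/-- General homotopy, target 0. -/
lemma deg_homotopy (H : ℝ → ℂ → ℂ) {D : Set ℂ} (hD : IsOpen D) (hb : IsBounded D)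
    (hc : ContinuousOn (fun p : ℝ × ℂ => H p.1 p.2) (Icc (0:ℝ) 1 ×ˢ closure D))
    (h0 : ∀ t ∈ Icc (0:ℝ) 1, ∀ x ∈ frontier D, H t x ≠ 0) :
    𝒟.deg (H 0) D 0 = 𝒟.deg (H 1) D 0 :=
  𝒟.homotopy_invariance H D (fun _ => 0) hD hb hc continuousOn_const h0

lemma deg_linear {F₀ F₁ : ℂ → ℂ} {D : Set ℂ} (hD : IsOpen D) (hb : IsBounded D)
    (h₀ : ContinuousOn F₀ (closure D)) (h₁ : ContinuousOn F₁ (closure D))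
    (h : ∀ x ∈ frontier D, ∀ s : ℝ, 0 ≤ s → s ≤ 1 → ((1 - s : ℝ) : ℂ) * F₀ x + (s : ℂ) * F₁ x ≠ 0) :
    𝒟.deg F₀ D 0 = 𝒟.deg F₁ D 0 := by
  have := 𝒟.deg_homotopy (fun s x => ((1 - s : ℝ) : ℂ) * F₀ x + (s : ℂ) * F₁ x) hD hb ?_ ?_
  · simpa using this
  · have e₀ : ContinuousOn (fun p : ℝ × ℂ => F₀ p.2) (Icc (0:ℝ) 1 ×ˢ closure D) :=
      h₀.comp continuousOn_snd (fun p hp => hp.2)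
    have e₁ : ContinuousOn (fun p : ℝ × ℂ => F₁ p.2) (Icc (0:ℝ) 1 ×ˢ closure D) :=
      h₁.comp continuousOn_snd (fun p hp => hp.2)
    have a : ContinuousOn (fun p : ℝ × ℂ => ((1 - p.1 : ℝ) : ℂ)) (Icc (0:ℝ) 1 ×ˢ closure D) := by
      fun_prop
    have b : ContinuousOn (fun p : ℝ × ℂ => ((p.1 : ℝ) : ℂ)) (Icc (0:ℝ) 1 ×ˢ closure D) := by
      fun_prop
    exact (a.mul e₀).add (b.mul e₁)
  · intro t ht x hx
    exact h x hx t ht.1 ht.2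

lemma deg_congr_frontier {F₀ F₁ : ℂ → ℂ} {D : Set ℂ} (hD : IsOpen D) (hb : IsBounded D)
    (h₀ : ContinuousOn F₀ (closure D)) (h₁ : ContinuousOn F₁ (closure D))
    (h : ∀ x ∈ frontier D, F₀ x = F₁ x) (hn : ∀ x ∈ frontier D, F₀ x ≠ 0) :
    𝒟.deg F₀ D 0 = 𝒟.deg F₁ D 0 := by
  refine 𝒟.deg_linear hD hb h₀ h₁ (fun x hx s hs hs' => ?_)
  rw [← h x hx, ← add_mul]
  simpa using hn x hx

lemma deg_sub {a : ℂ} {D : Set ℂ} (hD : IsOpen D) (hb : IsBounded D) (ha : a ∈ D) :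
    𝒟.deg (fun z => z - a) D 0 = 1 := by
  have h := 𝒟.homotopy_invariance (fun t z => z - t * a) D (fun t => (1 - t) * a) hD hb
    (by fun_prop) (by fun_prop) ?_
  · have h2 := 𝒟.normalization D a hD hb ha
    have e : (fun z : ℂ => z - ((0:ℝ):ℂ) * a) = id := by ext z; simp
    rw [e] at h
    simp only [Complex.ofReal_one, one_mul, sub_self, zero_mul, Complex.ofReal_zero, sub_zero] at h
    rw [← h, h2]
  · intro t ht x hx heq
    have : x = a := by
      have : x - t * a = (1 - t) * a := heq
      linear_combination this
    rw [this, hD.frontier_eq] at hx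
    exact hx.2 ha

lemma deg_mul_exp {f : ℂ → ℂ} {c : ℂ} {D : Set ℂ} (hD : IsOpen D) (hb : IsBounded D)
    (hf : ContinuousOn f (closure D)) (hn : ∀ x ∈ frontier D, f x ≠ 0) (hc : c ≠ 0) :
    𝒟.deg (fun z => c * f z) D 0 = 𝒟.deg f D 0 := by
  have h := 𝒟.deg_homotopy (fun t z => Complex.exp (t * Complex.log c) * f z) hD hb ?_ ?_
  · simp only [Complex.ofReal_one, one_mul, zero_mul, Complex.ofReal_zero, Complex.exp_zero,
      Complex.exp_log hc] at h
    exact h.symm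
  · refine ContinuousOn.mul (by fun_prop) ?_
    exact hf.comp continuousOn_snd (fun p hp => hp.2)
  · intro t _ x hx
    exact mul_ne_zero (Complex.exp_ne_zero _) (hn x hx)

/-- perturbation: if `‖F₁ - F₀‖ < ‖F₀‖` on the frontier, the degrees agree. -/
lemma deg_rouche {F₀ F₁ : ℂ → ℂ} {D : Set ℂ} (hD : IsOpen D) (hb : IsBounded D)
    (h₀ : ContinuousOn F₀ (closure D)) (h₁ : ContinuousOn F₁ (closure D))
    (h : ∀ x ∈ frontier D, ‖F₁ x - F₀ x‖ < ‖F₀ x‖) :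
    𝒟.deg F₀ D 0 = 𝒟.deg F₁ D 0 := by
  refine 𝒟.deg_linear hD hb h₀ h₁ (fun x hx s hs hs' heq => ?_)
  have e : F₀ x = -(s * (F₁ x - F₀ x)) := by
    push_cast at heq
    linear_combination heq
  have h1 := h x hx
  have h2 : ‖F₀ x‖ = s * ‖F₁ x - F₀ x‖ := by
    conv_lhs => rw [e]
    rw [norm_neg, norm_mul, Complex.norm_real, Real.norm_of_nonneg hs]
  nlinarith [norm_nonneg (F₁ x - F₀ x)]

/-- local degree at a simple zero -/
lemma exists_deg_simple {f : ℂ → ℂ} {a c : ℂ} (hc : c ≠ 0) (hf : HasDerivAt f c a) (h0 : f a = 0)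
    {U : Set ℂ} (hU : IsOpen U) (haU : a ∈ U) (hfc : ContinuousOn f U) :
    ∃ r₀ > 0, ∀ r, 0 < r → r ≤ r₀ → 𝒟.deg f (ball a r) 0 = 1 := by
  have hlo := hasDerivAt_iff_isLittleO.1 hf
  have hcpos : 0 < ‖c‖ := norm_pos_iff.2 hc
  have hev := hlo.def (half_pos hcpos)
  obtain ⟨r₁, hr₁, h₁⟩ := Metric.eventually_nhds_iff_ball.1 hev
  obtain ⟨r₂, hr₂, h₂⟩ := Metric.isOpen_iff.1 hU a haU
  refine ⟨min r₁ r₂ / 2, by positivity, fun r hr hr' => ?_⟩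
  have hcl : closure (ball a r) ⊆ ball a (min r₁ r₂) := by
    refine closure_ball_subset_closedBall.trans (closedBall_subset_ball ?_)
    have : 0 < min r₁ r₂ := by positivity
    linarith
  have hd := 𝒟.deg_rouche (F₀ := fun z => c * (z - a)) (F₁ := f) (D := ball a r) isOpen_ball
    isBounded_ball (by fun_prop)
    (hfc.mono (hcl.trans ((ball_subset_ball (min_le_right _ _)).trans h₂))) ?_
  · rw [← hd, 𝒟.deg_mul_exp isOpen_ball isBounded_ball (by fun_prop) _ hc,
      𝒟.deg_sub isOpen_ball isBounded_ball (mem_ball_self hr)]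
    intro x hx
    rw [frontier_ball _ hr.ne'] at hx
    rw [sub_ne_zero]
    rintro rfl
    simp at hx
    linarith
  · intro x hx
    have hx1 := hcl (frontier_subset_closure hx)
    rw [frontier_ball _ hr.ne', mem_sphere, dist_eq_norm] at hx
    have := h₁ x (ball_subset_ball (min_le_left _ _) hx1)
    rw [h0, sub_zero, smul_eq_mul, hx] at this
    have e : f x - c * (x - a) = f x - (x - a) * c := by ring
    rw [e, norm_mul, hx]
    nlinarith


lemma deg_conj_ball (a : ℂ) : 𝒟.deg (fun z => -(starRingEnd ℂ (z - a))) (ball a 1) 0 = -1 := by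
  set F : ℝ → ℂ → ℂ := fun s z =>
    (((z - a).re * ((z - a).re - 2) + 2 * s : ℝ) : ℂ) + ((z - a).im : ℂ) * Complex.I with hF
  have hFc : ∀ s, Continuous (F s) := fun s => by simp only [hF]; fun_prop
  have hre : ∀ s z, (F s z).re = (z - a).re * ((z - a).re - 2) + 2 * s := by
    intro s z; simp [hF]
  have him : ∀ s z, (F s z).im = (z - a).im := by
    intro s z; simp [hF]
  have nsq : ∀ w : ℂ, ‖w‖ ^ 2 = w.re * w.re + w.im * w.im := fun w => by
    rw [← Complex.normSq_eq_norm_sq, Complex.normSq_apply]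
  have h1 : 𝒟.deg (F 0) (ball (a + 1) 3) 0 = 0 := by
    rw [𝒟.deg_homotopy F isOpen_ball isBounded_ball (by simp only [hF]; fun_prop)]
    · refine 𝒟.deg_eq_zero isOpen_ball isBounded_ball (hFc 1).continuousOn (fun x _ h => ?_)
      have := hre 1 x
      rw [h] at this
      simp only [Complex.zero_re] at this
      nlinarith [sq_nonneg ((x - a).re - 1)]
    · intro t ht x hx h
      rw [frontier_ball _ (by norm_num), mem_sphere, dist_eq_norm] at hx
      have e1 := hre t x
      have e2 := him t x
      rw [h] at e1 e2
      have := nsq (x - (a + 1))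
      rw [hx] at this
      simp at this e1 e2
      nlinarith [ht.1, ht.2]
  have h2 : 𝒟.deg (F 0) (ball (a + 1) 3) 0
      = 𝒟.deg (F 0) (ball a 1) 0 + 𝒟.deg (F 0) (ball (a + 2) 1) 0 := by
    refine 𝒟.deg_add isOpen_ball isBounded_ball (hFc 0).continuousOn isOpen_ball isOpen_ball
      ?_ ?_ ?_ ?_
    · refine ball_subset_ball' ?_
      simp [dist_eq_norm]; norm_num
    · refine ball_subset_ball' ?_
      rw [dist_eq_norm]
      have : a + 2 - (a + 1) = 1 := by ring
      rw [this]; simp; norm_num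
    · refine ball_disjoint_ball ?_
      simp [dist_eq_norm]; norm_num
    · intro x _ hx1 hx2 h
      have e1 := hre 0 x
      have e2 := him 0 x
      rw [h] at e1 e2
      simp only [Complex.zero_re, Complex.zero_im, mul_zero, add_zero] at e1 e2
      rcases mul_eq_zero.1 e1.symm with h' | h'
      · apply hx1
        have : x - a = 0 := Complex.ext (by simpa using h') (by simpa using e2.symm)
        rw [sub_eq_zero] at this
        simp [this]
      · apply hx2
        have : x - a = 2 := Complex.ext (by simp at h' ⊢; linarith) (by simpa using e2.symm)
        have : x = a + 2 := by linear_combination this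
        simp [this]
  have h3 : 𝒟.deg (F 0) (ball (a + 2) 1) 0 = 1 := by
    rw [𝒟.deg_linear (F₁ := fun z => z - (a + 2)) isOpen_ball isBounded_ball
      (hFc 0).continuousOn (by fun_prop), 𝒟.deg_sub isOpen_ball isBounded_ball (by simp)]
    intro x hx s hs hs' h
    rw [frontier_ball _ (by norm_num), mem_sphere, dist_eq_norm] at hx
    have hn := nsq (x - (a + 2))
    rw [hx] at hn
    have e1 := congrArg Complex.re h
    have e2 := congrArg Complex.im h
    simp [hre, him] at e1 e2 hn
    have h4 : (x.im - a.im) = 0 := by linear_combination e2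
    have h5 : (x.re - a.re - 2) * ((1 - s) * (x.re - a.re) + s) = 0 := by linear_combination e1
    rw [h4] at hn
    rcases mul_eq_zero.1 h5 with h6 | h6
    · nlinarith
    · have : 1 ≤ x.re - a.re := by nlinarith
      nlinarith
  have h4 : 𝒟.deg (F 0) (ball a 1) 0 = 𝒟.deg (fun z => -(starRingEnd ℂ (z - a))) (ball a 1) 0 := by
    refine 𝒟.deg_linear isOpen_ball isBounded_ball
      (hFc 0).continuousOn (Continuous.continuousOn (by fun_prop)) ?_
    intro x hx s hs hs' h
    rw [frontier_ball _ (by norm_num), mem_sphere, dist_eq_norm] at hx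
    have hn := nsq (x - a)
    rw [hx] at hn
    have e1 := congrArg Complex.re h
    have e2 := congrArg Complex.im h
    simp [hre, him] at e1 e2 hn
    have h4 : (x.im - a.im) = 0 := by linear_combination e2
    have h5 : (x.re - a.re) * ((1 - s) * (2 - (x.re - a.re)) + s) = 0 := by linear_combination -e1
    rw [h4] at hn
    rcases mul_eq_zero.1 h5 with h6 | h6
    · nlinarith
    · have : x.re - a.re ≤ 1 := by nlinarith
      nlinarith
  rw [h1, h3, h4] at h2
  linarith

lemma deg_conj {a c : ℂ} (hc : c ≠ 0) {D : Set ℂ} (hD : IsOpen D) (hb : IsBounded D) (ha : a ∈ D) :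
    𝒟.deg (fun z => c * (starRingEnd ℂ (z - a))) D 0 = -1 := by
  have key : 𝒟.deg (fun z => -(starRingEnd ℂ (z - a))) D 0 = -1 := by
    rw [← 𝒟.deg_conj_ball a]
    have hc : Continuous (fun z => -(starRingEnd ℂ (z - a))) := by fun_prop
    have hz : ∀ x, x ≠ a → -(starRingEnd ℂ (x - a)) ≠ 0 := fun x hx => by
      rw [neg_ne_zero, ne_eq, map_eq_zero, sub_eq_zero]; exact hx
    rw [𝒟.deg_excision (D₁ := D ∩ ball a 1) hD hb hc.continuousOn (hD.inter isOpen_ball)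
      inter_subset_left,
      𝒟.deg_excision (D := ball a 1) (D₁ := D ∩ ball a 1) isOpen_ball isBounded_ball
        hc.continuousOn (hD.inter isOpen_ball) inter_subset_right]
    · intro x _ hx
      refine hz x ?_
      rintro rfl
      exact hx ⟨ha, by simp⟩
    · intro x _ hx
      refine hz x ?_
      rintro rfl
      exact hx ⟨ha, by simp⟩
  rw [← key, ← 𝒟.deg_mul_exp (f := fun z => -(starRingEnd ℂ (z - a))) hD hb
    (Continuous.continuousOn (by fun_prop)) _ (neg_ne_zero.2 hc)]
  · simp only [neg_mul_neg]
  · intro x hx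
    have : x ≠ a := by
      rintro rfl
      rw [hD.frontier_eq] at hx
      exact hx.2 ha
    rw [neg_ne_zero, ne_eq, map_eq_zero, sub_eq_zero]; exact this

lemma deg_nonneg_of_finite {f : ℂ → ℂ} (T : Finset ℂ) : ∀ {D : Set ℂ}, IsOpen D → IsBounded D →
    ContinuousOn f (closure D) → (T : Set ℂ) ⊆ D → (∀ x ∈ closure D, x ∉ T → f x ≠ 0) →
    (∀ a ∈ T, ∃ r₀ > 0, ∀ r, 0 < r → r ≤ r₀ → 0 ≤ 𝒟.deg f (ball a r) 0) →
    0 ≤ 𝒟.deg f D 0 := by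
  classical
  induction T using Finset.induction_on with
  | empty =>
    intro D hD hb hf _ hz _
    rw [𝒟.deg_eq_zero hD hb hf (fun x hx => hz x hx (by simp))]
  | insert a T haT ih =>
    intro D hD hb hf hT hz hloc
    have haD : a ∈ D := hT (by simp)
    obtain ⟨r₀, hr₀, h₀⟩ := hloc a (by simp)
    have hO : IsOpen (D ∩ (T : Set ℂ)ᶜ) := hD.inter (T.finite_toSet.isClosed.isOpen_compl)
    obtain ⟨r₁, hr₁, h₁⟩ := Metric.isOpen_iff.1 hO a ⟨haD, by simpa using haT⟩
    set r := min r₀ (r₁ / 2) with hr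
    have hrpos : 0 < r := by positivity
    have hcb : closedBall a r ⊆ ball a r₁ := closedBall_subset_ball (by
      have := min_le_right r₀ (r₁ / 2); rw [← hr] at this; linarith)
    have hcb2 := hcb.trans h₁
    have hdec := 𝒟.deg_add (f := f) (D₁ := ball a r) (D₂ := D \ closedBall a r) (y := 0) hD hb hf
      isOpen_ball (hD.sdiff isClosed_closedBall)
      (fun x hx => (hcb2 (ball_subset_closedBall hx)).1) sdiff_subset
      (disjoint_left.2 fun x hx hx' => hx'.2 (ball_subset_closedBall hx)) ?_
    · rw [hdec]
      refine add_nonneg (h₀ r hrpos (min_le_left _ _)) (ih (hD.sdiff isClosed_closedBall)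
        (hb.subset sdiff_subset) (hf.mono (closure_mono sdiff_subset)) ?_ ?_ ?_)
      · intro x hx
        refine ⟨hT (by simp [Finset.mem_coe.1 hx]), fun h => (hcb2 h).2 hx⟩
      · intro x hx hxT
        refine hz x (closure_mono sdiff_subset hx) ?_
        rw [Finset.mem_insert, not_or]
        refine ⟨?_, hxT⟩
        rintro rfl
        have : closure (D \ closedBall x r) ⊆ (ball x r)ᶜ :=
          closure_minimal (fun y hy hy' => hy.2 (ball_subset_closedBall hy'))
            isOpen_ball.isClosed_compl
        exact this hx (mem_ball_self hrpos)
      · exact fun b hb => hloc b (by simp [hb])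
    · intro x hx hx1 hx2
      refine hz x hx ?_
      intro hxT
      have hxD : x ∈ D := hT hxT
      have hxcb : x ∈ closedBall a r := by
        by_contra h
        exact hx2 ⟨hxD, h⟩
      rw [Finset.mem_insert] at hxT
      rcases hxT with rfl | h
      · exact hx1 (mem_ball_self hrpos)
      · exact (hcb2 hxcb).2 h

end BrouwerDegreeTheory
end

section


lemma deg_nonneg_of_extends (𝒟 : BrouwerDegreeTheory ℂ) {D : Set ℂ} (hD : IsOpen D)
    (hb : IsBounded D) {f : ℂ → ℂ} (hf : ContinuousOn f (closure D)) (hd : DifferentiableOn ℂ f D)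
    (hn : ∀ z ∈ frontier D, f z ≠ 0) : 0 ≤ 𝒟.deg f D 0 := by
  have hK : IsCompact (closure D) := hb.isCompact_closure
  have hFr : IsCompact (frontier D) := hK.of_isClosed_subset isClosed_frontier
    frontier_subset_closure
  obtain ⟨m, hm, hmf⟩ : ∃ m > 0, ∀ z ∈ frontier D, m ≤ ‖f z‖ := by
    rcases (frontier D).eq_empty_or_nonempty with h | h
    · exact ⟨1, one_pos, by simp [h]⟩
    · obtain ⟨z, hz, hz'⟩ := hFr.exists_isMinOn h (hf.mono frontier_subset_closure).norm
      exact ⟨‖f z‖, norm_pos_iff.2 (hn z hz), fun w hw => hz' hw⟩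
  have hda : ∀ z ∈ D, HasDerivAt f (deriv f z) z := fun z hz =>
    ((hd z hz).differentiableAt (hD.mem_nhds hz)).hasDerivAt
  -- Sard
  have hs : MeasureTheory.volume (f '' {z ∈ D | deriv f z = 0}) = 0 := by
    refine MeasureTheory.addHaar_image_eq_zero_of_det_fderivWithin_eq_zero
      (f' := fun _ => 0) _ (fun z hz => ?_) (fun z _ => ?_)
    · have h1 := (hda z hz.1)
      rw [hz.2] at h1
      have h2 := h1.hasFDerivAt.restrictScalars ℝ
      refine HasFDerivAt.hasFDerivWithinAt ?_
      convert h2 using 1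
      ext <;> simp
    · simp [ContinuousLinearMap.det]
  obtain ⟨y, hy, hyc⟩ : ∃ y ∈ ball (0:ℂ) m, y ∉ f '' {z ∈ D | deriv f z = 0} := by
    by_contra! h
    have h1 : MeasureTheory.volume (ball (0:ℂ) m) ≤ 0 := hs ▸ MeasureTheory.measure_mono h
    exact (measure_ball_pos MeasureTheory.volume (0:ℂ) hm).not_ge h1
  have hym : ‖y‖ < m := by simpa using hy
  set g : ℂ → ℂ := fun z => f z - y with hg
  have hgc : ContinuousOn g (closure D) := hf.sub continuousOn_const
  rw [𝒟.deg_rouche (F₁ := g) hD hb hf hgc (fun x hx => by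
    simp only [hg, sub_sub_cancel_left, norm_neg]; exact hym.trans_le (hmf x hx))]
  set Z : Set ℂ := {z ∈ closure D | g z = 0} with hZ
  have hZD : Z ⊆ D := by
    intro z hz
    by_contra h
    have hzf : z ∈ frontier D := by rw [hD.frontier_eq]; exact ⟨hz.1, h⟩
    have h1 := hmf z hzf
    have h2 : f z = y := sub_eq_zero.1 hz.2
    rw [h2] at h1
    linarith
  have hZc : IsClosed Z := by
    have := hgc.preimage_isClosed_of_isClosed isClosed_closure (isClosed_singleton (x := (0:ℂ)))
    exact this
  have hZn : ∀ z ∈ Z, deriv f z ≠ 0 := by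
    intro z hz h
    exact hyc ⟨z, ⟨hZD hz, h⟩, sub_eq_zero.1 hz.2⟩
  have hgd : ∀ z ∈ D, HasDerivAt g (deriv f z) z := fun z hz => (hda z hz).sub_const y
  have hfin : Z.Finite := by
    by_contra hinf
    obtain ⟨x, hx, hacc⟩ := Set.Infinite.exists_accPt_of_subset_isCompact hinf hK
      (fun z hz => hz.1)
    have hxZ : x ∈ Z := hZc.closure_subset (mem_closure_iff_clusterPt.2 hacc.clusterPt)
    have h1 := (hgd x (hZD hxZ)).eventually_ne (c := 0) (hZn x hxZ)
    rw [accPt_iff_frequently_nhdsNE] at hacc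
    obtain ⟨w, hw1, hw2⟩ := (hacc.and_eventually h1).exists
    exact hw2 hw1.2
  refine 𝒟.deg_nonneg_of_finite hfin.toFinset hD hb hgc (by simpa using hZD) ?_ ?_
  · intro x hx hx' h
    exact hx' (by simpa using ⟨hx, h⟩)
  · intro a ha
    have haZ : a ∈ Z := by simpa using ha
    obtain ⟨r₀, hr₀, h⟩ := 𝒟.exists_deg_simple (hZn a haZ) (hgd a (hZD haZ)) haZ.2 hD (hZD haZ)
      (hgc.mono subset_closure)
    exact ⟨r₀, hr₀, fun r h1 h2 => by rw [h r h1 h2]; norm_num⟩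

/-- The easy direction. -/
lemma forward_direction (D : Set ℂ) (hDopen : IsOpen D) (hDbdd : IsBounded D)
    (𝒟 : BrouwerDegreeTheory ℂ) (Φ : ℂ → ℂ) (h : ExtendsHolomorphically Φ D)
    (U : Set ℂ) (G : ℂ → ℂ) (hDU : closure D ⊆ U) (hG : DifferentiableOn ℂ G U)
    (hn : ∀ z ∈ frontier D, Φ z + G z ≠ 0) (F : ℂ → ℂ) (hF : ContinuousOn F (closure D))
    (hFe : ∀ z ∈ frontier D, F z = Φ z + G z) : 0 ≤ 𝒟.deg F D 0 := by
  obtain ⟨g, hgc, hgd, hge⟩ := h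
  have e : ∀ z ∈ frontier D, F z = g z + G z := fun z hz => by rw [hFe z hz, hge z hz]
  have hc : ContinuousOn (fun z => g z + G z) (closure D) := hgc.add (hG.continuousOn.mono hDU)
  rw [𝒟.deg_congr_frontier hDopen hDbdd hF hc e (fun z hz => by rw [hFe z hz]; exact hn z hz)]
  refine deg_nonneg_of_extends 𝒟 hDopen hDbdd hc (hgd.add (hG.mono (subset_closure.trans hDU))) ?_
  intro z hz
  rw [← e z hz, hFe z hz]
  exact hn z hz
end

section


/-- the real inner product on the complex plane -/
def ip (a b : ℂ) : ℝ := a.re * b.re + a.im * b.im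

lemma ip_self (a : ℂ) : ip a a = ‖a‖ ^ 2 := by
  rw [← Complex.normSq_eq_norm_sq, Complex.normSq_apply]; rfl

lemma abs_ip_le (a b : ℂ) : |ip a b| ≤ ‖a‖ * ‖b‖ := by
  have : ip a b = (a * starRingEnd ℂ b).re := by simp [ip]
  rw [this]
  refine (Complex.abs_re_le_norm _).trans ?_
  simp

lemma ip_sub_left (a b c : ℂ) : ip (a - b) c = ip a c - ip b c := by simp [ip]; ring
lemma ip_add_left (a b c : ℂ) : ip (a + b) c = ip a c + ip b c := by simp [ip]; ring
lemma ip_sub_right (a b c : ℂ) : ip a (b - c) = ip a b - ip a c := by simp [ip]; ring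
lemma ip_smul_left (t : ℝ) (a b : ℂ) : ip (t * a) b = t * ip a b := by simp [ip]; ring
lemma ip_smul_right (t : ℝ) (a b : ℂ) : ip a (t * b) = t * ip a b := by simp [ip]; ring
lemma ip_neg_left (a b : ℂ) : ip (-a) b = - ip a b := by simp [ip]; ring
lemma ip_comm (a b : ℂ) : ip a b = ip b a := by simp [ip]; ring

/-- outer unit normal at a boundary point, with cone parameters `ε`, `l`. -/
def ConeAt (D : Set ℂ) (ε l : ℝ) (p n : ℂ) : Prop :=
  ∀ x, ‖x - p‖ < l → (ε * ‖x - p‖ < ip (x - p) n → x ∉ closure D) ∧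
    (ε * ‖x - p‖ < - ip (x - p) n → x ∈ D)

structure NormalField (D : Set ℂ) (ν : ℂ → ℂ) : Prop where
  cont : ContinuousOn ν (frontier D)
  unit : ∀ p ∈ frontier D, ‖ν p‖ = 1
  cone : ∀ ε > 0, ∃ l > 0, ∀ p ∈ frontier D, ConeAt D ε l p (ν p)

lemma cone_unique {D : Set ℂ} {p n₁ n₂ : ℂ} (h₁ : ‖n₁‖ = 1) (h₂ : ‖n₂‖ = 1)
    (c₁ : ∀ ε > 0, ∃ l > 0, ConeAt D ε l p n₁) (c₂ : ∀ ε > 0, ∃ l > 0, ConeAt D ε l p n₂) :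
    n₁ = n₂ := by
  by_contra hne
  have hv : 0 < ‖n₁ - n₂‖ := norm_pos_iff.2 (sub_ne_zero.2 hne)
  obtain ⟨l₁, hl₁, H₁⟩ := c₁ (‖n₁ - n₂‖ / 4) (by positivity)
  obtain ⟨l₂, hl₂, H₂⟩ := c₂ (‖n₁ - n₂‖ / 4) (by positivity)
  set v := n₁ - n₂ with hvdef
  have e1 := ip_self v
  have e11 := ip_self n₁
  have e22 := ip_self n₂
  rw [h₁] at e11
  rw [h₂] at e22
  have hvv : ‖v‖ ^ 2 = 2 - 2 * ip n₁ n₂ := by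
    rw [← e1, hvdef, ip_sub_left, ip_sub_right, ip_sub_right, e11, e22, ip_comm n₂ n₁]; ring
  have f1 : ip v n₁ = ‖v‖ ^ 2 / 2 := by
    rw [hvv, hvdef, ip_sub_left, e11, ip_comm n₂ n₁]; ring
  have f2 : ip v n₂ = - (‖v‖ ^ 2 / 2) := by
    rw [hvv, hvdef, ip_sub_left, e22]; ring
  set t := min l₁ l₂ / (2 * ‖v‖) with ht
  have htpos : 0 < t := by positivity
  have hx : (p + t * v) - p = t * v := by ring
  have hnx : ‖(p + t * v) - p‖ = t * ‖v‖ := by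
    rw [hx, norm_mul, Complex.norm_real, Real.norm_of_nonneg htpos.le]
  have htv : t * ‖v‖ = min l₁ l₂ / 2 := by rw [ht]; field_simp
  have hmin : 0 < min l₁ l₂ := by positivity
  have a1 := (H₁ (p + t * v) (by rw [hnx, htv]; linarith [min_le_left l₁ l₂])).1 (by
    rw [hnx, hx, ip_smul_left, f1]; nlinarith [mul_pos htpos (mul_pos hv hv)])
  have a2 := (H₂ (p + t * v) (by rw [hnx, htv]; linarith [min_le_right l₁ l₂])).2 (by
    rw [hnx, hx, ip_smul_left, f2]; nlinarith [mul_pos htpos (mul_pos hv hv)])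
  exact a1 (subset_closure a2)

lemma local_normal {D : Set ℂ} (hDo : IsOpen D) (h : HasCkBoundary 1 D) {p₀ : ℂ}
    (hp₀ : p₀ ∈ frontier D) :
    ∃ (U : Set ℂ) (m : ℂ → ℂ), IsOpen U ∧ p₀ ∈ U ∧ ContinuousOn m U ∧ (∀ p ∈ U, ‖m p‖ = 1) ∧
      ∀ q ∈ U, ∀ ε > 0, ∃ r > 0, ∀ p ∈ frontier D, ‖p - q‖ < r → ∀ x, ‖x - q‖ < r →
        (ε * ‖x - p‖ < ip (x - p) (m p) → x ∉ closure D) ∧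
        (ε * ‖x - p‖ < - ip (x - p) (m p) → x ∈ D) := by
  obtain ⟨U, ρ, hU, hpU, hρ, hne, hD, hF⟩ := h p₀ hp₀
  set n : ℂ → ℂ := fun p => (fderiv ℝ ρ p 1 : ℂ) + (fderiv ℝ ρ p Complex.I : ℂ) * Complex.I with hn
  have hρ1 : ContDiffOn ℝ 1 ρ U := hρ
  have hfd : ContinuousOn (fderiv ℝ ρ) U := hρ1.continuousOn_fderiv_of_isOpen hU le_rfl
  have hip : ∀ p v, fderiv ℝ ρ p v = ip v (n p) := by
    intro p v
    have hv : v = v.re • (1:ℂ) + v.im • Complex.I := by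
      apply Complex.ext <;> simp
    conv_lhs => rw [hv]
    rw [map_add, map_smul, map_smul]
    simp [ip, hn]
  have hnc : ContinuousOn n U := by
    have h1 : ContinuousOn (fun p => fderiv ℝ ρ p 1) U := hfd.clm_apply continuousOn_const
    have h2 : ContinuousOn (fun p => fderiv ℝ ρ p Complex.I) U := hfd.clm_apply continuousOn_const
    exact (Complex.continuous_ofReal.comp_continuousOn h1).add
      ((Complex.continuous_ofReal.comp_continuousOn h2).mul continuousOn_const)
  have hn0 : ∀ p ∈ U, n p ≠ 0 := by
    intro p hp h0
    apply hne p hp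
    ext v
    rw [hip, h0]
    simp [ip]
  refine ⟨U, fun p => ((‖n p‖⁻¹ : ℝ) : ℂ) * n p, hU, hpU, ?_, ?_, ?_⟩
  · refine ContinuousOn.mul (Complex.continuous_ofReal.comp_continuousOn ?_) hnc
    exact hnc.norm.inv₀ (fun p hp => norm_ne_zero_iff.2 (hn0 p hp))
  · intro p hp
    rw [norm_mul, Complex.norm_real, norm_inv, norm_norm]
    exact inv_mul_cancel₀ (norm_ne_zero_iff.2 (hn0 p hp))
  · intro q hq ε hε
    have hN : 0 < ‖n q‖ := norm_pos_iff.2 (hn0 q hq)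
    have hstrict : HasStrictFDerivAt ρ (fderiv ℝ ρ q) q :=
      (hρ1.contDiffAt (hU.mem_nhds hq)).hasStrictFDerivAt (by norm_num)
    have hlo := hstrict.isLittleO.def (c := ε * ‖n q‖ / 8) (by positivity)
    rw [Metric.eventually_nhds_iff_ball] at hlo
    obtain ⟨r₁, hr₁, H₁⟩ := hlo
    have hcq : ContinuousAt n q := hnc.continuousAt (hU.mem_nhds hq)
    obtain ⟨r₂, hr₂, H₂⟩ := Metric.continuousAt_iff.1 hcq (min (ε * ‖n q‖ / 8) (‖n q‖ / 2))
      (by positivity)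
    obtain ⟨r₃, hr₃, H₃⟩ := Metric.isOpen_iff.1 hU q hq
    refine ⟨min r₁ (min r₂ r₃), by positivity, ?_⟩
    intro p hp hpq x hxq
    simp only [lt_min_iff] at hpq hxq
    have hxU : x ∈ U := H₃ (by simpa [dist_eq_norm] using hxq.2.2)
    have hpU' : p ∈ U := H₃ (by simpa [dist_eq_norm] using hpq.2.2)
    have hρp : ρ p = 0 := by
      have : p ∈ frontier D ∩ U := ⟨hp, hpU'⟩
      rw [hF] at this
      exact this.2
    have k1 := H₁ (x, p) (by
      rw [mem_ball, Prod.dist_eq, max_lt_iff]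
      simp only [dist_eq_norm]
      exact ⟨hxq.1, hpq.1⟩)
    simp only [hρp, sub_zero, hip, Real.norm_eq_abs] at k1
    have k2 := H₂ (x := p) (by simpa [dist_eq_norm] using hpq.2.1)
    rw [lt_min_iff, dist_eq_norm] at k2
    have k3 : |ip (x - p) (n p) - ip (x - p) (n q)| ≤ ‖x - p‖ * (ε * ‖n q‖ / 8) := by
      rw [← ip_sub_right]
      exact (abs_ip_le _ _).trans (mul_le_mul_of_nonneg_left k2.1.le (norm_nonneg _))
    have k4 : ‖n q‖ / 2 ≤ ‖n p‖ := by
      have := norm_sub_norm_le (n q) (n p)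
      rw [norm_sub_rev] at this
      linarith [k2.2]
    have hNp : 0 < ‖n p‖ := by linarith
    have key : ∀ c : ℝ, ε * ‖x - p‖ < c * ip (x - p) ((‖n p‖⁻¹ : ℝ) * n p) →
        ε * ‖n q‖ / 2 * ‖x - p‖ < c * ip (x - p) (n p) := by
      intro c hc
      rw [ip_smul_right] at hc
      have : ε * ‖x - p‖ * ‖n p‖ < c * ip (x - p) (n p) := by
        have := mul_lt_mul_of_pos_right hc hNp
        calc _ < _ := this
          _ = _ := by field_simp
      nlinarith [mul_nonneg hε.le (norm_nonneg (x - p))]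
    rw [abs_le] at k1 k3
    have hnonneg : 0 ≤ ε * ‖n q‖ * ‖x - p‖ := by positivity
    constructor
    · intro hlt hx
      have := key 1 (by simpa using hlt)
      have hpos : 0 < ρ x := by nlinarith
      rcases (closure_eq_self_union_frontier D ▸ hx : x ∈ D ∪ frontier D) with h' | h'
      · have : x ∈ D ∩ U := ⟨h', hxU⟩
        rw [hD] at this
        have := this.2
        linarith
      · have : x ∈ frontier D ∩ U := ⟨h', hxU⟩
        rw [hF] at this
        have := this.2
        linarith
    · intro hlt
      have := key (-1) (by simpa using hlt)
      have hneg : ρ x < 0 := by nlinarith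
      have : x ∈ D ∩ U := by rw [hD]; exact ⟨hxU, hneg⟩
      exact this.1

lemma exists_normalField {D : Set ℂ} (hDo : IsOpen D) (hb : IsBounded D) (h : HasCkBoundary 1 D) :
    ∃ ν, NormalField D ν := by
  have hFr : IsCompact (frontier D) := hb.isCompact_closure.of_isClosed_subset isClosed_frontier
    frontier_subset_closure
  choose! U m hU hpU hmc hm1 hm using fun p₀ (hp₀ : p₀ ∈ frontier D) => local_normal hDo h hp₀
  have hcone : ∀ p₀ ∈ frontier D, ∀ q ∈ frontier D, q ∈ U p₀ → ∀ ε > 0, ∃ l > 0,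
      ConeAt D ε l q (m p₀ q) := by
    intro p₀ hp₀ q hq hqU ε hε
    obtain ⟨r, hr, H⟩ := hm p₀ hp₀ q hqU ε hε
    exact ⟨r, hr, fun x hx => H q hq (by simpa using hr) x hx⟩
  set ν : ℂ → ℂ := fun p => m p p with hν
  have hνm : ∀ p₀ ∈ frontier D, ∀ q ∈ frontier D, q ∈ U p₀ → ν q = m p₀ q := by
    intro p₀ hp₀ q hq hqU
    exact cone_unique (hm1 q hq q (hpU q hq)) (hm1 p₀ hp₀ q hqU)
      (hcone q hq q hq (hpU q hq)) (hcone p₀ hp₀ q hq hqU)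
  refine ⟨ν, ?_, ?_, ?_⟩
  · intro p hp
    have h1 : ContinuousWithinAt (m p) (frontier D) p :=
      ((hmc p hp).continuousAt ((hU p hp).mem_nhds (hpU p hp))).continuousWithinAt
    refine h1.congr_of_eventuallyEq ?_ rfl
    filter_upwards [self_mem_nhdsWithin, mem_nhdsWithin_of_mem_nhds ((hU p hp).mem_nhds (hpU p hp))]
      with q hq hqU using hνm p hp q hq hqU
  · intro p hp
    exact hm1 p hp p (hpU p hp)
  · intro ε hε
    have : ∀ q ∈ frontier D, ∃ r > 0, ∀ p ∈ frontier D, ‖p - q‖ < r → ∀ x, ‖x - q‖ < r →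
        (ε * ‖x - p‖ < ip (x - p) (ν p) → x ∉ closure D) ∧
        (ε * ‖x - p‖ < - ip (x - p) (ν p) → x ∈ D) := by
      intro q hq
      obtain ⟨r, hr, H⟩ := hm q hq q (hpU q hq) ε hε
      obtain ⟨r', hr', H'⟩ := Metric.isOpen_iff.1 (hU q hq) q (hpU q hq)
      refine ⟨min r r', by positivity, fun p hp hpq x hxq => ?_⟩
      rw [lt_min_iff] at hpq hxq
      rw [hνm q hq p hp (H' (by simpa [dist_eq_norm] using hpq.2))]
      exact H p hp hpq.1 x hxq.1
    choose! r hr H using this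
    obtain ⟨δ, hδ, Hδ⟩ := lebesgue_number_lemma_of_metric hFr
      (c := fun q : frontier D => ball (q:ℂ) (r q)) (fun q => isOpen_ball)
      (fun q hq => mem_iUnion.2 ⟨⟨q, hq⟩, mem_ball_self (hr q hq)⟩)
    refine ⟨δ, hδ, fun p hp x hx => ?_⟩
    obtain ⟨q, hq⟩ := Hδ p hp
    have h1 := hq (mem_ball_self hδ)
    have h2 := hq (show x ∈ ball p δ by simpa [dist_eq_norm] using hx)
    rw [mem_ball, dist_eq_norm] at h1 h2
    exact H q q.2 p hp h1 x h2
end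

section


lemma tietze_complex {K : Set ℂ} (hK : IsClosed K) {Φ : ℂ → ℂ} (hΦ : ContinuousOn Φ K) :
    ∃ Ψ : ℂ → ℂ, Continuous Ψ ∧ ∀ z ∈ K, Ψ z = Φ z := by
  obtain ⟨g, hg⟩ := ContinuousMap.exists_restrict_eq hK ⟨K.domRestrict Φ, hΦ.domRestrict⟩
  refine ⟨g, g.continuous, fun z hz => ?_⟩
  exact congrArg (fun f : C(K, ℂ) => f ⟨z, hz⟩) hg

lemma preconnected_subset_of_frontier {S D : Set ℂ} (hS : IsPreconnected S) (hD : IsOpen D)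
    (hne : (S ∩ D).Nonempty) (hfr : ∀ y ∈ S, y ∉ frontier D) : S ⊆ D := by
  refine hS.subset_of_closure_inter_subset hD hne (fun y hy => ?_)
  by_contra h
  exact hfr y hy.2 (by rw [hD.frontier_eq]; exact ⟨hy.1, h⟩)

namespace NormalField
variable {D : Set ℂ} {ν : ℂ → ℂ}

lemma tangent (hν : NormalField D ν) (hD : IsOpen D) {ε : ℝ} (hε : 0 < ε) :
    ∃ l > 0, ∀ p ∈ frontier D, ∀ ζ ∈ frontier D, ‖ζ - p‖ < l →
      |ip (ζ - p) (ν p)| ≤ ε * ‖ζ - p‖ := by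
  obtain ⟨l, hl, H⟩ := hν.cone ε hε
  refine ⟨l, hl, fun p hp ζ hζ h => ?_⟩
  have h1 := H p hp ζ h
  rw [abs_le]
  constructor
  · by_contra! h'
    have := h1.2 (by linarith)
    rw [hD.frontier_eq] at hζ
    exact hζ.2 this
  · by_contra! h'
    exact h1.1 h' (frontier_subset_closure hζ)

lemma exists_radius (hν : NormalField D ν) :
    ∃ t₀ > 0, ∀ p ∈ frontier D, ∀ t : ℝ, 0 < t → t ≤ t₀ →
      (∀ x, ‖x - (p + t * ν p)‖ < t / 4 → x ∉ closure D) ∧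
      (∀ x, ‖x - (p - t * ν p)‖ < t / 4 → x ∈ D) := by
  obtain ⟨l, hl, H⟩ := hν.cone (1/2) (by norm_num)
  refine ⟨l / 2, by positivity, fun p hp t ht htl => ?_⟩
  have hu := hν.unit p hp
  have hs : ip (ν p) (ν p) = 1 := by rw [ip_self, hu]; norm_num
  have key : ∀ (c : ℝ) (x : ℂ), |c| = 1 → ‖x - (p + (c * t : ℝ) * ν p)‖ < t / 4 →
      ‖x - p‖ < 5 * t / 4 ∧ 3 * t / 4 < c * ip (x - p) (ν p) := by
    intro c x hc hx
    set e := x - (p + (c * t : ℝ) * ν p) with he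
    have hxp : x - p = (c * t : ℝ) * ν p + e := by rw [he]; ring
    have hcc : c * c = 1 := by rw [← abs_mul_abs_self, hc]; norm_num
    constructor
    · rw [hxp]
      refine (norm_add_le _ _).trans_lt ?_
      rw [norm_mul, hu, Complex.norm_real, Real.norm_eq_abs, abs_mul, hc, abs_of_pos ht]
      linarith
    · rw [hxp, ip_add_left, ip_smul_left, hs]
      have h1 := abs_ip_le e (ν p)
      rw [hu, mul_one] at h1
      have h2 : |c * ip e (ν p)| ≤ ‖e‖ := by rw [abs_mul, hc, one_mul]; exact h1
      have h3 := (abs_le.1 h2).1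
      have : c * (c * t * 1 + ip e (ν p)) = t + c * ip e (ν p) := by linear_combination t * hcc
      rw [this]
      linarith
  constructor
  · intro x hx
    obtain ⟨h1, h2⟩ := key 1 x (by simp) (by simpa using hx)
    exact (H p hp x (by linarith)).1 (by linarith)
  · intro x hx
    obtain ⟨h1, h2⟩ := key (-1) x (by simp) (by
      have : p + ((-1 * t : ℝ) : ℂ) * ν p = p - t * ν p := by push_cast; ring
      rw [this]; exact hx)
    exact (H p hp x (by linarith)).2 (by linarith)

lemma local_component (hν : NormalField D ν) (hD : IsOpen D) {p : ℂ} (hp : p ∈ closure D) :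
    ∃ r > 0, ∃ x₀ ∈ D, D ∩ ball p r ⊆ connectedComponentIn D x₀ := by
  by_cases hpD : p ∈ D
  · obtain ⟨r, hr, H⟩ := Metric.isOpen_iff.1 hD p hpD
    refine ⟨r, hr, p, hpD, inter_subset_right.trans ?_⟩
    exact (convex_ball p r).isPreconnected.subset_connectedComponentIn (mem_ball_self hr) H
  have hpf : p ∈ frontier D := by rw [hD.frontier_eq]; exact ⟨hp, hpD⟩
  obtain ⟨t₀, ht₀, HB⟩ := hν.exists_radius
  obtain ⟨l, hl, HC⟩ := hν.cone (1/2) (by norm_num)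
  obtain ⟨δ, hδ, Hδ⟩ := Metric.continuousWithinAt_iff.1 (hν.cont p hpf) (1/4) (by norm_num)
  set t := min t₀ (min (l / 2) (δ / 2)) with ht
  have htpos : 0 < t := by positivity
  have ht1 : t ≤ t₀ := min_le_left _ _
  have ht2 : t ≤ l / 2 := (min_le_right _ _).trans (min_le_left _ _)
  have ht3 : t ≤ δ / 2 := (min_le_right _ _).trans (min_le_right _ _)
  have hu := hν.unit p hpf
  set x₀ := p - t * ν p with hx₀
  have hball : ball x₀ (t / 4) ⊆ D := fun x hx => (HB p hpf t htpos ht1).2 x (by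
    simpa [dist_eq_norm] using hx)
  have hx₀b : x₀ ∈ ball x₀ (t / 4) := mem_ball_self (by positivity)
  have hsub : ball x₀ (t / 4) ⊆ connectedComponentIn D x₀ :=
    (convex_ball x₀ _).isPreconnected.subset_connectedComponentIn hx₀b hball
  refine ⟨t / 4, by positivity, x₀, hball hx₀b, ?_⟩
  rintro x ⟨hxD, hxp⟩
  rw [mem_ball, dist_eq_norm] at hxp
  set S : Set ℂ := (fun s : ℝ => x - s * ν p) '' Icc 0 t with hS
  have hSc : IsPreconnected S := isPreconnected_Icc.image _ (by fun_prop)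
  have hxS : x ∈ S := ⟨0, ⟨le_rfl, htpos.le⟩, by simp⟩
  have hyS : x - t * ν p ∈ S := ⟨t, ⟨htpos.le, le_rfl⟩, rfl⟩
  have hSD : S ⊆ D := by
    refine preconnected_subset_of_frontier hSc hD ⟨x, hxS, hxD⟩ ?_
    rintro _ ⟨s, ⟨hs0, hst⟩, rfl⟩ hf
    simp only at hf
    set y := x - s * ν p with hy
    have hs : 0 < s := by
      rcases hs0.eq_or_lt with h | h
      · rw [hy, ← h, hD.frontier_eq] at hf
        simp [hxD] at hf
      · exact h
    have hyp : ‖y - p‖ < δ := by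
      have : y - p = (x - p) - s * ν p := by rw [hy]; ring
      rw [this]
      refine (norm_sub_le _ _).trans_lt ?_
      rw [norm_mul, hu, Complex.norm_real, Real.norm_of_nonneg hs0]
      linarith
    have h1 := Hδ hf (by simpa [dist_eq_norm] using hyp)
    rw [dist_eq_norm] at h1
    have hxy : x - y = s * ν p := by rw [hy]; ring
    have hnxy : ‖x - y‖ = s := by
      rw [hxy, norm_mul, hu, Complex.norm_real, Real.norm_of_nonneg hs0, mul_one]
    have h2 : 3 / 4 ≤ ip (ν p) (ν y) := by
      have e : ip (ν p) (ν y) = ip (ν p) (ν p) + ip (ν p) (ν y - ν p) := by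
        rw [ip_sub_right]; ring
      have := abs_ip_le (ν p) (ν y - ν p)
      rw [hu, one_mul] at this
      have := (abs_le.1 this).1
      rw [e, ip_self, hu]
      linarith
    refine (HC y hf x (by rw [hnxy]; linarith)).1 ?_ (subset_closure hxD)
    rw [hnxy, hxy, ip_smul_left]
    nlinarith
  have h1 : x - t * ν p ∈ connectedComponentIn D x₀ := hsub (by
    rw [mem_ball, dist_eq_norm, hx₀]
    have : x - t * ν p - (p - t * ν p) = x - p := by ring
    rw [this]; exact hxp)
  rw [connectedComponentIn_eq h1]
  exact hSc.subset_connectedComponentIn hyS hSD hxS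

lemma comp_nhds (hν : NormalField D ν) (hD : IsOpen D) {x₀ p : ℂ}
    (hp : p ∈ closure (connectedComponentIn D x₀)) :
    ∃ r > 0, D ∩ ball p r ⊆ connectedComponentIn D x₀ := by
  obtain ⟨r, hr, x₁, _, H⟩ := hν.local_component hD
    (closure_mono (connectedComponentIn_subset D x₀) hp)
  obtain ⟨y, hy, hy'⟩ := Metric.mem_closure_iff.1 hp r hr
  have h1 := H ⟨connectedComponentIn_subset D x₀ hy, by rwa [mem_ball, dist_comm]⟩
  refine ⟨r, hr, ?_⟩
  rw [connectedComponentIn_eq hy, ← connectedComponentIn_eq h1]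
  exact H

lemma comp_frontier (hν : NormalField D ν) (hD : IsOpen D) (x₀ : ℂ) :
    frontier (connectedComponentIn D x₀) ⊆ frontier D := by
  intro p hp
  rw [hD.connectedComponentIn.frontier_eq] at hp
  rw [hD.frontier_eq]
  refine ⟨closure_mono (connectedComponentIn_subset D x₀) hp.1, fun h => hp.2 ?_⟩
  obtain ⟨r, hr, H⟩ := hν.comp_nhds hD hp.1
  exact H ⟨h, mem_ball_self hr⟩

lemma comp_disjoint (hν : NormalField D ν) (hD : IsOpen D) (x₀ : ℂ) :
    Disjoint (closure (connectedComponentIn D x₀)) (closure (D \ connectedComponentIn D x₀)) := by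
  refine disjoint_left.2 fun p hp hp' => ?_
  obtain ⟨r, hr, H⟩ := hν.comp_nhds hD hp
  obtain ⟨y, hy, hy'⟩ := Metric.mem_closure_iff.1 hp' r hr
  exact hy.2 (H ⟨hy.1, by rwa [mem_ball, dist_comm]⟩)

lemma comp_compl_open (hν : NormalField D ν) (hD : IsOpen D) (x₀ : ℂ) :
    IsOpen (D \ connectedComponentIn D x₀) := by
  have : D \ connectedComponentIn D x₀ = D \ closure (connectedComponentIn D x₀) := by
    ext z
    constructor
    · rintro ⟨h1, h2⟩
      refine ⟨h1, fun h => ?_⟩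
      exact disjoint_left.1 (hν.comp_disjoint hD x₀) h (subset_closure ⟨h1, h2⟩)
    · rintro ⟨h1, h2⟩
      exact ⟨h1, fun h => h2 (subset_closure h)⟩
  rw [this]
  exact hD.sdiff isClosed_closure

lemma comp (hν : NormalField D ν) (hD : IsOpen D) (hb : IsBounded D) (x₀ : ℂ) :
    NormalField (connectedComponentIn D x₀) ν := by
  refine ⟨hν.cont.mono (hν.comp_frontier hD x₀), fun p hp => hν.unit p (hν.comp_frontier hD x₀ hp),
    fun ε hε => ?_⟩
  obtain ⟨l, hl, H⟩ := hν.cone ε hε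
  obtain ⟨δ, hδ, hdis⟩ := (hν.comp_disjoint hD x₀).exists_thickenings
    ((hb.subset (connectedComponentIn_subset D x₀)).isCompact_closure) isClosed_closure
  refine ⟨min l δ, by positivity, fun p hp x hx => ?_⟩
  rw [lt_min_iff] at hx
  have h1 := H p (hν.comp_frontier hD x₀ hp) x hx.1
  refine ⟨fun h h' => h1.1 h (closure_mono (connectedComponentIn_subset D x₀) h'), fun h => ?_⟩
  by_contra h'
  have hxK : x ∈ closure (D \ connectedComponentIn D x₀) := subset_closure ⟨h1.2 h, h'⟩
  exact disjoint_left.1 hdis (mem_thickening_iff.2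
    ⟨p, frontier_subset_closure hp, by rw [dist_eq_norm]; exact hx.2⟩)
    (self_subset_thickening hδ _ hxK)

end NormalField

/-- The degree hypothesis. -/
def DegHyp (𝒟 : BrouwerDegreeTheory ℂ) (D : Set ℂ) (Φ : ℂ → ℂ) : Prop :=
  ∀ (U : Set ℂ) (G : ℂ → ℂ),
        IsOpen U → closure D ⊆ U → DifferentiableOn ℂ G U →
        (∀ z ∈ frontier D, Φ z + G z ≠ 0) →
        ∀ F : ℂ → ℂ,
          ContinuousOn F (closure D) →
          (∀ z ∈ frontier D, F z = Φ z + G z) →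
          0 ≤ 𝒟.deg F D 0

lemma DegHyp.comp {𝒟 : BrouwerDegreeTheory ℂ} {D : Set ℂ} {Φ ν : ℂ → ℂ} (h : DegHyp 𝒟 D Φ)
    (hν : NormalField D ν) (hD : IsOpen D) (hb : IsBounded D) (hΦ : ContinuousOn Φ (frontier D))
    (x₀ : ℂ) : DegHyp 𝒟 (connectedComponentIn D x₀) Φ := by
  classical
  set C' := connectedComponentIn D x₀ with hC'
  have hCD : C' ⊆ D := connectedComponentIn_subset D x₀
  have hCo : IsOpen C' := hD.connectedComponentIn
  have hdis := hν.comp_disjoint hD x₀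
  have hEo := hν.comp_compl_open hD x₀
  have hCf := hν.comp_frontier hD x₀
  rw [← hC'] at hdis hEo hCf
  have hEb : IsBounded (D \ C') := hb.subset sdiff_subset
  have hCb : IsBounded C' := hb.subset hCD
  have hunion : closure D = closure C' ∪ closure (D \ C') := by
    rw [← closure_union, union_sdiff_cancel hCD]
  intro U G hU hCU hG hn F hF hFe
  obtain ⟨V₁, V₂, hV₁, hV₂, hCV, hEV, hVV⟩ := SeparatedNhds.of_isCompact_isCompact
    hCb.isCompact_closure hEb.isCompact_closure hdis
  have hFr : IsCompact (frontier D) := hb.isCompact_closure.of_isClosed_subset isClosed_frontier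
    frontier_subset_closure
  obtain ⟨M₀, hM₀⟩ := hFr.exists_bound_of_continuousOn hΦ
  set M : ℝ := max M₀ 0 + 1 with hM
  have hMpos : 0 < M := by positivity
  have hMb : ∀ z ∈ frontier D, ‖Φ z‖ < M := fun z hz =>
    (hM₀ z hz).trans_lt ((le_max_left _ _).trans_lt (lt_add_one _))
  have hMne : ∀ z ∈ frontier D, ∀ s : ℝ, 0 ≤ s → s ≤ 1 → (s:ℂ) * Φ z + M ≠ 0 := by
    intro z hz s hs hs' h0
    have e : (M:ℂ) = -(s * Φ z) := by linear_combination h0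
    have : M = s * ‖Φ z‖ := by
      have := congrArg norm e
      rwa [norm_neg, norm_mul, Complex.norm_real, Complex.norm_real, Real.norm_of_nonneg hMpos.le,
        Real.norm_of_nonneg hs] at this
    nlinarith [hMb z hz, norm_nonneg (Φ z)]
  obtain ⟨Ψ, hΨ, hΨe⟩ := tietze_complex isClosed_frontier hΦ
  have hfrmem : ∀ z ∈ frontier D, z ∈ closure C' → z ∈ frontier C' := by
    intro z hz hzC
    rw [hCo.frontier_eq]
    rw [hD.frontier_eq] at hz
    exact ⟨hzC, fun h' => hz.2 (hCD h')⟩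
  have hEf : frontier (D \ C') ⊆ frontier D := by
    intro z hz
    rw [hEo.frontier_eq] at hz
    rw [hD.frontier_eq]
    refine ⟨closure_mono sdiff_subset hz.1, fun h' => ?_⟩
    by_cases hzC : z ∈ C'
    · exact disjoint_left.1 hdis (subset_closure hzC) hz.1
    · exact hz.2 ⟨h', hzC⟩
  set G' : ℂ → ℂ := fun z => if z ∈ V₁ then G z else M with hG'
  set F' : ℂ → ℂ := fun z => if z ∈ V₁ then F z else Ψ z + M with hF'
  have hC1 : ∀ z ∈ closure C', z ∈ V₁ := fun z hz => hCV hz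
  have hE1 : ∀ z ∈ V₂, z ∉ V₁ := fun z hz h' => disjoint_left.1 hVV h' hz
  have hval : ∀ z ∈ frontier D, (z ∈ closure C' ∧ z ∈ frontier C' ∧ z ∈ V₁) ∨
      (z ∈ closure (D \ C') ∧ z ∉ V₁) := by
    intro z hz
    have hz' := frontier_subset_closure hz
    rw [hunion] at hz'
    rcases hz' with h' | h'
    · exact Or.inl ⟨h', hfrmem z hz h', hC1 z h'⟩
    · exact Or.inr ⟨h', hE1 z (hEV h')⟩
  have hG'd : DifferentiableOn ℂ G' ((U ∩ V₁) ∪ V₂) := by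
    rintro z (hz | hz)
    · have : G' =ᶠ[nhds z] G := by
        filter_upwards [hV₁.mem_nhds hz.2] with w hw
        simp [hG', hw]
      exact (((hG z hz.1).differentiableAt (hU.mem_nhds hz.1)).congr_of_eventuallyEq
        this).differentiableWithinAt
    · have : G' =ᶠ[nhds z] fun _ => (M:ℂ) := by
        filter_upwards [hV₂.mem_nhds hz] with w hw
        simp [hG', hE1 w hw]
      exact ((differentiableAt_const _).congr_of_eventuallyEq this).differentiableWithinAt
  have hF'C : ContinuousOn F' (closure C') :=
    hF.congr (fun z hz => by simp [hF', hC1 z hz])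
  have hF'E : ContinuousOn F' (closure (D \ C')) := by
    refine ((hΨ.add (continuous_const (y := (M:ℂ)))).continuousOn (s := closure (D \ C'))).congr
      (fun z hz => by simp [hF', hE1 z (hEV hz)])
  have hF'c : ContinuousOn F' (closure D) := by
    rw [hunion]
    exact hF'C.union_of_isClosed hF'E isClosed_closure isClosed_closure
  have hn' : ∀ z ∈ frontier D, Φ z + G' z ≠ 0 := by
    intro z hz
    rcases hval z hz with ⟨_, h2, h3⟩ | ⟨_, h2⟩
    · simpa [hG', h3] using hn z h2
    · simpa [hG', h2] using hMne z hz 1 zero_le_one le_rfl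
  have he' : ∀ z ∈ frontier D, F' z = Φ z + G' z := by
    intro z hz
    rcases hval z hz with ⟨_, h2, h3⟩ | ⟨_, h2⟩
    · simpa [hG', hF', h3] using hFe z h2
    · simp [hG', hF', h2, hΨe z hz]
  have hsubU : closure D ⊆ (U ∩ V₁) ∪ V₂ := by
    rw [hunion]
    exact union_subset_union (subset_inter hCU hCV) hEV
  have key := h _ G' ((hU.inter hV₁).union hV₂) hsubU hG'd hn' F' hF'c he'
  rw [𝒟.deg_add (D₁ := C') (D₂ := D \ C') hD hb hF'c hCo hEo hCD sdiff_subset disjoint_sdiff_right] at key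
  · have e1 : 𝒟.deg F' C' 0 = 𝒟.deg F C' 0 := by
      refine 𝒟.deg_congr_frontier hCo hCb hF'C hF (fun z hz => ?_) (fun z hz => ?_)
      · simp [hF', hC1 z (frontier_subset_closure hz)]
      · rw [he' z (hCf hz)]
        exact hn' z (hCf hz)
    have e2 : 𝒟.deg F' (D \ C') 0 = 0 := by
      rw [𝒟.deg_linear (F₁ := fun _ => (M:ℂ)) hEo hEb hF'E continuousOn_const]
      · refine 𝒟.deg_eq_zero hEo hEb continuousOn_const (fun z _ => ?_)
        exact_mod_cast hMpos.ne'
      · intro z hz s hs hs'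
        have h2 : z ∉ V₁ := hE1 z (hEV (frontier_subset_closure hz))
        have : F' z = Φ z + M := by simp [hF', h2, hΨe z (hEf hz)]
        rw [this]
        have := hMne z (hEf hz) (1 - s) (by linarith) (by linarith)
        intro h0
        apply this
        rw [← h0]
        push_cast
        ring
    rw [e1, e2, add_zero] at key
    exact key
  · intro z hz h1 h2
    have hzf : z ∈ frontier D := by
      rw [hD.frontier_eq]
      refine ⟨hz, fun h' => ?_⟩
      by_cases hzC : z ∈ C'
      · exact h1 hzC
      · exact h2 ⟨h', hzC⟩
    rw [he' z hzf]
    exact hn' z hzf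

lemma extends_of_comp {D : Set ℂ} {Φ ν : ℂ → ℂ}
    (hν : NormalField D ν) (hD : IsOpen D)
    (h : ∀ x₀ ∈ D, ExtendsHolomorphically Φ (connectedComponentIn D x₀)) :
    ExtendsHolomorphically Φ D := by
  have h' : ∀ S : Set ℂ, (∃ x₀ ∈ D, S = connectedComponentIn D x₀) →
      ExtendsHolomorphically Φ S := by
    rintro S ⟨x₀, hx₀, rfl⟩
    exact h x₀ hx₀
  choose! g hgc hgd hge using h'
  choose! r hr x hx H using fun p (hp : p ∈ closure D) => hν.local_component hD hp
  have hcl : ∀ p ∈ closure D, closure D ∩ ball p (r p) ⊆ closure (connectedComponentIn D (x p)) := by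
    intro p hp
    rw [inter_comm]
    exact (isOpen_ball.inter_closure).trans (closure_mono (by rw [inter_comm]; exact H p hp))
  have huniq : ∀ x₁ ∈ D, ∀ p ∈ closure (connectedComponentIn D x₁),
      connectedComponentIn D (x p) = connectedComponentIn D x₁ := by
    intro x₁ hx₁ p hp
    have hpD := closure_mono (connectedComponentIn_subset D x₁) hp
    obtain ⟨y, hy, hy'⟩ := Metric.mem_closure_iff.1 hp (r p) (hr p hpD)
    have h1 := H p hpD ⟨connectedComponentIn_subset D x₁ hy, by rwa [mem_ball, dist_comm]⟩
    rw [connectedComponentIn_eq hy, ← connectedComponentIn_eq h1]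
  set gg : ℂ → ℂ := fun z => g (connectedComponentIn D (x z)) z with hgg
  have hgeq : ∀ x₁ ∈ D, ∀ z ∈ closure (connectedComponentIn D x₁),
      gg z = g (connectedComponentIn D x₁) z := by
    intro x₁ hx₁ z hz
    simp only [hgg, huniq x₁ hx₁ z hz]
  refine ⟨gg, ?_, ?_, ?_⟩
  · intro p hp
    have hpc : p ∈ closure (connectedComponentIn D (x p)) :=
      hcl p hp ⟨hp, mem_ball_self (hr p hp)⟩
    have h1 : ContinuousWithinAt gg (closure (connectedComponentIn D (x p))) p :=
      ((hgc _ ⟨x p, hx p hp, rfl⟩) p hpc).congr (fun z hz => hgeq _ (hx p hp) z hz)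
        (hgeq _ (hx p hp) p hpc)
    refine h1.mono_of_mem_nhdsWithin ?_
    refine Filter.mem_of_superset (inter_mem_nhdsWithin _ (ball_mem_nhds p (hr p hp))) (hcl p hp)
  · intro p hp
    have hpc : p ∈ connectedComponentIn D p := mem_connectedComponentIn hp
    have ho : IsOpen (connectedComponentIn D p) := hD.connectedComponentIn
    have h1 := ((hgd _ ⟨p, hp, rfl⟩) p hpc).differentiableAt (ho.mem_nhds hpc)
    refine (h1.congr_of_eventuallyEq ?_).differentiableWithinAt
    filter_upwards [ho.mem_nhds hpc] with z hz using hgeq p hp z (subset_closure hz)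
  · intro z hz
    have hzD := frontier_subset_closure hz
    have hpc : z ∈ closure (connectedComponentIn D (x z)) :=
      hcl z hzD ⟨hzD, mem_ball_self (hr z hzD)⟩
    refine hge _ ⟨x z, hx z hzD, rfl⟩ z ?_
    have ho : IsOpen (connectedComponentIn D (x z)) := hD.connectedComponentIn
    rw [ho.frontier_eq]
    rw [hD.frontier_eq] at hz
    exact ⟨hpc, fun h' => hz.2 (connectedComponentIn_subset D _ h')⟩
end

section


section kernel
variable {X : Type*} [TopologicalSpace X] [CompactSpace X]

/-- apply `l` in the second variable -/
def innerApply (l : C(X, ℝ) →L[ℝ] ℝ) (k : C(X × X, ℝ)) : C(X, ℝ) :=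
  ⟨fun p => l (k.curry p), l.continuous.comp k.curry.continuous⟩

/-- apply `l` in both variables -/
def biApply (l : C(X, ℝ) →L[ℝ] ℝ) : C(X × X, ℝ) →ₗ[ℝ] ℝ where
  toFun k := l (innerApply l k)
  map_add' k k' := by
    rw [← map_add]
    congr 1
    ext p
    simp only [innerApply, ContinuousMap.coe_mk, ContinuousMap.add_apply, ← map_add]
    rfl
  map_smul' c k := by
    rw [RingHom.id_apply, ← map_smul]
    congr 1
    ext p
    simp only [innerApply, ContinuousMap.coe_mk, ContinuousMap.smul_apply, ← map_smul]
    rfl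

lemma biApply_apply (l : C(X, ℝ) →L[ℝ] ℝ) (k : C(X × X, ℝ)) :
    biApply l k = l (innerApply l k) := rfl

lemma abs_le_of_bound (l : C(X, ℝ) →L[ℝ] ℝ) (k : C(X, ℝ)) {M : ℝ} (hM : 0 ≤ M)
    (h : ∀ x, |k x| ≤ M) : |l k| ≤ ‖l‖ * M := by
  have h1 : ‖k‖ ≤ M := (ContinuousMap.norm_le _ hM).2 h
  exact (l.le_opNorm k).trans (mul_le_mul_of_nonneg_left h1 (norm_nonneg _))

lemma biApply_bound (l : C(X, ℝ) →L[ℝ] ℝ) (k : C(X × X, ℝ)) {M : ℝ} (hM : 0 ≤ M)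
    (h : ∀ x, |k x| ≤ M) : |biApply l k| ≤ ‖l‖ * (‖l‖ * M) := by
  refine abs_le_of_bound l _ (by positivity) (fun p => ?_)
  exact abs_le_of_bound l _ hM (fun x => h (p, x))

/-- pure tensor -/
def tens (a b : C(X, ℝ)) : C(X × X, ℝ) := ⟨fun q => a q.1 * b q.2, by fun_prop⟩

lemma biApply_tens (l : C(X, ℝ) →L[ℝ] ℝ) (a b : C(X, ℝ)) :
    biApply l (tens a b) = l a * l b := by
  rw [biApply_apply]
  have : innerApply l (tens a b) = l b • a := by
    ext p
    have : (tens a b).curry p = a p • b := by ext x; simp [tens]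
    simp only [innerApply, ContinuousMap.coe_mk, this, map_smul, ContinuousMap.smul_apply,
      smul_eq_mul]
    ring
  rw [this, map_smul, smul_eq_mul]
  ring

/-- the Gram kernel -/
def gram {n : ℕ} (g : Fin n → C(X, ℝ)) : C(X × X, ℝ) := ∑ i, tens (g i) (g i)

lemma gram_pow {n : ℕ} (g : Fin n → C(X, ℝ)) (m : ℕ) :
    gram g ^ m = ∑ w : Fin m → Fin n, tens (∏ i, g (w i)) (∏ i, g (w i)) := by
  rw [gram, Fintype.sum_pow]
  refine Finset.sum_congr rfl (fun w _ => ?_)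
  ext q
  simp [tens, ContinuousMap.prod_apply, Finset.prod_mul_distrib]

lemma biApply_gram_pow (l : C(X, ℝ) →L[ℝ] ℝ) {n : ℕ} (g : Fin n → C(X, ℝ)) (m : ℕ) :
    biApply l (gram g ^ m) = ∑ w : Fin m → Fin n, (l (∏ i, g (w i))) ^ 2 := by
  rw [gram_pow, map_sum]
  refine Finset.sum_congr rfl (fun w _ => ?_)
  rw [biApply_tens, sq]

lemma biApply_gram_pow_nonneg (l : C(X, ℝ) →L[ℝ] ℝ) {n : ℕ} (g : Fin n → C(X, ℝ)) (m : ℕ) :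
    0 ≤ biApply l (gram g ^ m) := by
  rw [biApply_gram_pow]
  positivity

lemma functional_zero_of_words (l : C(X, ℝ) →L[ℝ] ℝ) (h1 : l 1 = 0) {n : ℕ} (g : Fin n → C(X, ℝ))
    (hsep : ∀ x y : X, (∀ i, g i x = g i y) → x = y)
    (hz : ∀ m : ℕ, 1 ≤ m → biApply l (gram g ^ m) = 0) : l = 0 := by
  have hw : ∀ (m : ℕ) (w : Fin m → Fin n), l (∏ i, g (w i)) = 0 := by
    intro m w
    rcases Nat.eq_zero_or_pos m with rfl | hm
    · simpa using h1
    · have := hz m hm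
      rw [biApply_gram_pow, Finset.sum_eq_zero_iff_of_nonneg (fun _ _ => sq_nonneg _)] at this
      exact pow_eq_zero_iff (two_ne_zero) |>.1 (this w (Finset.mem_univ _))
  have hdense : (Algebra.adjoin ℝ (range g)).topologicalClosure = ⊤ := by
    apply ContinuousMap.subalgebra_topologicalClosure_eq_top_of_separatesPoints
    intro x y hxy
    by_contra hcon
    refine hxy (hsep x y (fun i => ?_))
    by_contra hi
    exact hcon ⟨g i, ⟨g i, Algebra.subset_adjoin ⟨i, rfl⟩, rfl⟩, hi⟩
  refine ContinuousLinearMap.ext_on (s := (Submonoid.closure (range g) : Set C(X, ℝ))) ?_ ?_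
  · rw [← Algebra.adjoin_eq_span, dense_iff_closure_eq]
    have := congrArg (fun S : Subalgebra ℝ C(X, ℝ) => (S : Set C(X, ℝ))) hdense
    simpa using this
  · intro m hm
    obtain ⟨L, hL, rfl⟩ := Submonoid.exists_list_of_mem_closure hm
    have : ∃ w : Fin L.length → Fin n, ∀ i, L.get i = g (w i) := by
      choose w hw using fun i : Fin L.length => hL (L.get i) (L.get_mem i)
      exact ⟨w, fun i => (hw i).symm⟩
    obtain ⟨w, hw'⟩ := this
    have e : L.prod = ∏ i, g (w i) := by
      rw [← List.prod_ofFn]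
      have h2 : L.get = fun i => g (w i) := funext hw'
      rw [← h2, List.ofFn_get]
    rw [e, hw]
    simp

/-- Series positivity: if `biApply` of `log (1 - q * gram)` is small, so are the powers. -/
lemma biApply_log_lower (l : C(X, ℝ) →L[ℝ] ℝ) {n : ℕ} (g : Fin n → C(X, ℝ)) {q : ℝ} (hq0 : 0 ≤ q)
    (hq1 : q < 1) (hy : ∀ x, |gram g x| ≤ 1) (k : C(X × X, ℝ))
    (hk : ∀ x, k x = Real.log (1 - q * gram g x)) (m : ℕ) :
    q ^ (m + 1) * biApply l (gram g ^ (m + 1)) / (m + 1) ≤ - biApply l k := by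
  have hqy : ∀ x, |q * gram g x| ≤ q := fun x => by
    rw [abs_mul, abs_of_nonneg hq0]
    exact mul_le_of_le_one_right hq0 (hy x)
  have main : ∀ N : ℕ, m < N → q ^ (m + 1) * biApply l (gram g ^ (m + 1)) / (m + 1)
      ≤ - biApply l k + ‖l‖ * (‖l‖ * (q ^ (N + 1) / (1 - q))) := by
    intro N hN
    set s : C(X × X, ℝ) := ∑ i ∈ Finset.range N, (q ^ (i + 1) / ((i:ℝ) + 1)) • gram g ^ (i + 1)
      with hs
    have h1 : |biApply l (s + k)| ≤ ‖l‖ * (‖l‖ * (q ^ (N + 1) / (1 - q))) := by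
      refine biApply_bound l _ (div_nonneg (by positivity) (by linarith)) (fun x => ?_)
      have h2 := Real.abs_log_sub_add_sum_range_le (x := q * gram g x)
        ((hqy x).trans_lt hq1) N
      have h3 : (s + k) x = ∑ i ∈ Finset.range N, (q * gram g x) ^ (i + 1) / ((i:ℝ) + 1)
          + Real.log (1 - q * gram g x) := by
        rw [ContinuousMap.add_apply, hk, hs, ContinuousMap.sum_apply]
        congr 1
        refine Finset.sum_congr rfl (fun i _ => ?_)
        simp only [ContinuousMap.smul_apply, ContinuousMap.pow_apply, smul_eq_mul, mul_pow]
        ring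
      rw [h3]
      refine h2.trans ?_
      have := hqy x
      gcongr
    have h4 : biApply l s = ∑ i ∈ Finset.range N,
        (q ^ (i + 1) / ((i:ℝ) + 1)) * biApply l (gram g ^ (i + 1)) := by
      rw [hs, map_sum]
      simp
    have h5 : (q ^ (m + 1) / ((m:ℝ) + 1)) * biApply l (gram g ^ (m + 1)) ≤ biApply l s := by
      rw [h4]
      refine Finset.single_le_sum (f := fun i : ℕ =>
        (q ^ (i + 1) / ((i:ℝ) + 1)) * biApply l (gram g ^ (i + 1))) (fun i _ => ?_)
        (Finset.mem_range.2 hN)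
      exact mul_nonneg (by positivity) (biApply_gram_pow_nonneg l g _)
    rw [map_add] at h1
    have h6 := (abs_le.1 h1).2
    have h7 : q ^ (m + 1) * biApply l (gram g ^ (m + 1)) / (m + 1)
      = (q ^ (m + 1) / ((m:ℝ) + 1)) * biApply l (gram g ^ (m + 1)) := by ring
    rw [h7]
    linarith
  have hlim : Filter.Tendsto (fun N : ℕ => - biApply l k + ‖l‖ * (‖l‖ * (q ^ (N + 1) / (1 - q))))
      Filter.atTop (nhds (- biApply l k + ‖l‖ * (‖l‖ * (0 / (1 - q))))) := by
    have := (tendsto_pow_atTop_nhds_zero_of_lt_one hq0 hq1).comp (Filter.tendsto_add_atTop_nat 1)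
    exact ((((this.div_const _).const_mul _).const_mul _).const_add _)
  simp only [zero_div, mul_zero, add_zero] at hlim
  refine ge_of_tendsto hlim ?_
  filter_upwards [Filter.eventually_gt_atTop m] with N hN using main N hN


/-- the weight `1 + |z|^2`. -/
def wt (z : ℂ) : ℝ := 1 + ‖z‖ ^ 2

lemma wt_pos (z : ℂ) : 0 < wt z := by unfold wt; positivity

lemma wt_cont : Continuous wt := by unfold wt; fun_prop

lemma wt_eq (z : ℂ) : wt z = 1 + (z.re ^ 2 + z.im ^ 2) := by
  rw [wt, ← Complex.normSq_eq_norm_sq, Complex.normSq_apply]; ring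

/-- the four coordinate functions. -/
def coordFun (e : C(X, ℂ)) (i : Fin 4) : C(X, ℝ) where
  toFun x := (![1, √2 * (e x).re, √2 * (e x).im, (e x).re ^ 2 + (e x).im ^ 2] i) / wt (e x)
  continuous_toFun := by
    have h1 : Continuous fun x => wt (e x) := wt_cont.comp e.continuous
    have h2 : ∀ x, wt (e x) ≠ 0 := fun x => (wt_pos _).ne'
    fin_cases i
    · exact Continuous.div (by simp; fun_prop) h1 h2
    · exact Continuous.div (by simp; fun_prop) h1 h2
    · exact Continuous.div (by simp; fun_prop) h1 h2
    · exact Continuous.div (by simp; fun_prop) h1 h2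

lemma gram_coord (e : C(X, ℂ)) (q : X × X) :
    gram (coordFun e) q = (1 + 2 * ip (e q.1) (e q.2) +
      ((e q.1).re ^ 2 + (e q.1).im ^ 2) * ((e q.2).re ^ 2 + (e q.2).im ^ 2))
        / (wt (e q.1) * wt (e q.2)) := by
  have h2 : √2 * √2 = 2 := Real.mul_self_sqrt (by norm_num)
  have a := (wt_pos (e q.1)).ne'
  have b := (wt_pos (e q.2)).ne'
  rw [gram, ContinuousMap.sum_apply]
  simp only [tens, ContinuousMap.coe_mk, coordFun, Fin.sum_univ_four, ip]
  simp only [Matrix.cons_val]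
  field_simp
  linear_combination ((e q.1).re * (e q.2).re + (e q.1).im * (e q.2).im) * h2

lemma gram_coord_one_sub (e : C(X, ℂ)) (q : X × X) :
    (1 - gram (coordFun e) q) * (wt (e q.1) * wt (e q.2)) = ‖e q.2 - e q.1‖ ^ 2 := by
  have a := (wt_pos (e q.1)).ne'
  have b := (wt_pos (e q.2)).ne'
  rw [gram_coord, sub_mul, div_mul_cancel₀ _ (mul_ne_zero a b), wt_eq, wt_eq,
    ← Complex.normSq_eq_norm_sq, Complex.normSq_apply]
  simp [ip]
  ring

lemma gram_coord_abs (e : C(X, ℂ)) (q : X × X) : |gram (coordFun e) q| ≤ 1 := by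
  have a := (wt_pos (e q.1))
  have b := (wt_pos (e q.2))
  rw [abs_le]
  constructor
  · have : 0 ≤ gram (coordFun e) q := by
      rw [gram_coord]
      refine div_nonneg ?_ (by positivity)
      simp only [ip]
      nlinarith [sq_nonneg (1 + ((e q.1).re * (e q.2).re + (e q.1).im * (e q.2).im)),
        sq_nonneg ((e q.1).re * (e q.2).im - (e q.1).im * (e q.2).re)]
    linarith
  · have := gram_coord_one_sub e q
    have h2 : 0 ≤ ‖e q.2 - e q.1‖ ^ 2 := by positivity
    rw [← this] at h2
    have := nonneg_of_mul_nonneg_left h2 (mul_pos a b)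
    linarith

lemma functional_zero_of_kernel (e : C(X, ℂ)) (he : Function.Injective e)
    (l : C(X, ℝ) →L[ℝ] ℝ) (h1 : l 1 = 0)
    (H : ∀ ε > 0, ∃ t₁ > 0, ∀ t : ℝ, 0 < t → t ≤ t₁ → ∀ k : C(X × X, ℝ),
      (∀ q, k q = Real.log (‖e q.2 - e q.1‖ ^ 2 + t ^ 2 * (wt (e q.2) * wt (e q.1)))) →
      |biApply l k| ≤ ε) : l = 0 := by
  refine functional_zero_of_words l h1 (coordFun e) ?_ ?_
  · intro x y hxy
    apply he
    have h0 := hxy 0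
    have h1 := hxy 1
    have h2 := hxy 2
    simp only [coordFun, ContinuousMap.coe_mk, Matrix.cons_val] at h0 h1 h2
    have a := (wt_pos (e x)).ne'
    have b := (wt_pos (e y)).ne'
    have hw : wt (e x) = wt (e y) := by
      rw [div_eq_div_iff a b] at h0
      linarith
    have hs : √2 ≠ 0 := by positivity
    rw [hw] at h1 h2
    field_simp at h1 h2
    exact Complex.ext h1 h2
  · intro m' hm'
    obtain ⟨m, rfl⟩ : ∃ m, m' = m + 1 := ⟨m' - 1, by omega⟩
    refine le_antisymm ?_ (biApply_gram_pow_nonneg _ _ _)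
    refine le_of_forall_pos_le_add (fun ε hε => ?_)
    rw [zero_add]
    obtain ⟨t₁, ht₁, Ht⟩ := H (ε / ((m + 1) * 2 ^ (m + 1))) (by positivity)
    set t := min t₁ 1 with ht
    have htpos : 0 < t := by positivity
    have ht1 : t ≤ 1 := min_le_right _ _
    set q := (1 + t ^ 2)⁻¹ with hq
    have hq0 : 0 ≤ q := by positivity
    have hq1 : q < 1 := inv_lt_one_of_one_lt₀ (by nlinarith)
    have hq2 : 1 / 2 ≤ q := by
      rw [hq, one_div]
      exact inv_anti₀ (by positivity) (by nlinarith)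
    have hpos : ∀ x, 0 < 1 - q * gram (coordFun e) x := fun x => by
      have := (abs_le.1 (gram_coord_abs e x)).2
      nlinarith
    set k₀ : C(X × X, ℝ) := ⟨fun x => Real.log (1 - q * gram (coordFun e) x), by
      refine Continuous.log (by fun_prop) (fun x => (hpos x).ne')⟩ with hk₀
    have hlow := biApply_log_lower l (coordFun e) hq0 hq1 (gram_coord_abs e) k₀ (fun x => rfl) m
    have hwc : Continuous fun x => wt (e x) := wt_cont.comp e.continuous
    set lf : C(X, ℝ) := ⟨fun x => Real.log (wt (e x)), hwc.log (fun x => (wt_pos _).ne')⟩ with hlf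
    set k : C(X × X, ℝ) := k₀ + tens lf 1 + tens 1 lf + Real.log (1 + t ^ 2) • tens 1 1 with hk
    have hBk : biApply l k = biApply l k₀ := by
      rw [hk, map_add, map_add, map_add, map_smul, biApply_tens, biApply_tens, biApply_tens, h1]
      simp
    have hkk := Ht t htpos (min_le_left _ _) k (fun x => ?_)
    · rw [hBk] at hkk
      have h5 := (abs_le.1 hkk).1
      have h6 : q ^ (m + 1) * biApply l (gram (coordFun e) ^ (m + 1)) / (m + 1)
          ≤ ε / ((m + 1) * 2 ^ (m + 1)) := by linarith
      have hB := biApply_gram_pow_nonneg l (coordFun e) (m + 1)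
      have h7 : (1 / 2 : ℝ) ^ (m + 1) * biApply l (gram (coordFun e) ^ (m + 1)) / (m + 1)
          ≤ ε / ((m + 1) * 2 ^ (m + 1)) := by
        refine le_trans ?_ h6
        gcongr
      have h8 : (1 / 2 : ℝ) ^ (m + 1) * biApply l (gram (coordFun e) ^ (m + 1)) / (m + 1)
          = biApply l (gram (coordFun e) ^ (m + 1)) / ((m + 1) * 2 ^ (m + 1)) := by
        rw [one_div, inv_pow]
        field_simp
      rw [h8] at h7
      exact (div_le_div_iff_of_pos_right (by positivity)).1 h7
    · have a := wt_pos (e x.1)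
      have b := wt_pos (e x.2)
      have c : 0 < 1 + t ^ 2 := by positivity
      have e1 : ‖e x.2 - e x.1‖ ^ 2 + t ^ 2 * (wt (e x.2) * wt (e x.1))
          = (1 - q * gram (coordFun e) x) * wt (e x.1) * wt (e x.2) * (1 + t ^ 2) := by
        rw [← gram_coord_one_sub, hq]
        field_simp
        ring
      rw [e1, Real.log_mul (by have := hpos x; positivity) c.ne',
        Real.log_mul (by have := hpos x; positivity) b.ne',
        Real.log_mul (hpos x).ne' a.ne']
      simp [hk, hk₀, hlf, tens]
end kernel
end

section


/-- holomorphic in a neighbourhood of the closure of `D`. -/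
def HolNear (D : Set ℂ) (G : ℂ → ℂ) : Prop :=
  ∃ U, IsOpen U ∧ closure D ⊆ U ∧ DifferentiableOn ℂ G U

namespace HolNear
variable {D : Set ℂ} {G H : ℂ → ℂ}

lemma of_differentiable (h : Differentiable ℂ G) : HolNear D G :=
  ⟨univ, isOpen_univ, subset_univ _, h.differentiableOn⟩

lemma const (c : ℂ) : HolNear D (fun _ => c) := of_differentiable (by fun_prop)

lemma add (hG : HolNear D G) (hH : HolNear D H) : HolNear D (fun z => G z + H z) := by
  obtain ⟨U, hU, hDU, h⟩ := hG
  obtain ⟨V, hV, hDV, h'⟩ := hH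
  exact ⟨U ∩ V, hU.inter hV, subset_inter hDU hDV,
    (h.mono inter_subset_left).add (h'.mono inter_subset_right)⟩

lemma mul (hG : HolNear D G) (hH : HolNear D H) : HolNear D (fun z => G z * H z) := by
  obtain ⟨U, hU, hDU, h⟩ := hG
  obtain ⟨V, hV, hDV, h'⟩ := hH
  exact ⟨U ∩ V, hU.inter hV, subset_inter hDU hDV,
    (h.mono inter_subset_left).mul (h'.mono inter_subset_right)⟩

lemma sub (hG : HolNear D G) (hH : HolNear D H) : HolNear D (fun z => G z - H z) := by
  have := hG.add ((const (D := D) (-1)).mul hH)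
  convert this using 2
  ring

lemma continuousOn (hG : HolNear D G) : ContinuousOn G (closure D) := by
  obtain ⟨U, hU, hDU, h⟩ := hG
  exact h.continuousOn.mono hDU

lemma differentiableOn (hG : HolNear D G) : DifferentiableOn ℂ G D := by
  obtain ⟨U, hU, hDU, h⟩ := hG
  exact h.mono (subset_closure.trans hDU)

end HolNear

/-- real parts of functions holomorphic near the closure. -/
def reHol (D : Set ℂ) : Submodule ℝ C(frontier D, ℝ) where
  carrier := {w | ∃ G, HolNear D G ∧ ∀ x : frontier D, w x = (G x).re}
  add_mem' := by
    rintro w w' ⟨G, hG, h⟩ ⟨G', hG', h'⟩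
    exact ⟨_, hG.add hG', fun x => by simp [h, h']⟩
  zero_mem' := ⟨_, HolNear.const 0, fun x => by simp⟩
  smul_mem' := by
    rintro c w ⟨G, hG, h⟩
    exact ⟨_, (HolNear.const (c:ℂ)).mul hG, fun x => by simp [h]⟩

/-- functions constant at scale `δ` -/
def locConst (D : Set ℂ) (δ : ℝ) : Submodule ℝ C(frontier D, ℝ) where
  carrier := {c | ∀ p q : frontier D, ‖(p:ℂ) - q‖ < δ → c p = c q}
  add_mem' := by
    intro a b ha hb p q h
    simp [ha p q h, hb p q h]
  zero_mem' := by intro p q _; rfl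
  smul_mem' := by
    intro r a ha p q h
    simp [ha p q h]

open Classical in
/-- logarithmic kernel with pole `b`. -/
def lk (D : Set ℂ) (b : ℂ) : C(frontier D, ℝ) :=
  if h : b ∉ closure D then
    ⟨fun x => Real.log ‖(x:ℂ) - b‖, by
      refine Continuous.log (by fun_prop) (fun x => ?_)
      rw [norm_ne_zero_iff, sub_ne_zero]
      rintro rfl
      exact h (frontier_subset_closure x.2)⟩
  else 0

lemma lk_apply {D : Set ℂ} {b : ℂ} (h : b ∉ closure D) (x : frontier D) :
    lk D b x = Real.log ‖(x:ℂ) - b‖ := by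
  simp [lk, h]

lemma lk_sub_mem {D : Set ℂ} {b b' : ℂ} {r : ℝ} (h : ∀ x, ‖x - b‖ < r → x ∉ closure D)
    (hb' : ‖b' - b‖ < r) : lk D b' - lk D b ∈ reHol D := by
  have hr : 0 < r := (norm_nonneg _).trans_lt hb'
  have hbD : b ∉ closure D := h b (by simpa using hr)
  have hbD' : b' ∉ closure D := h b' hb'
  have hpos : ∀ z : ℂ, ‖b' - b‖ < ‖z - b‖ → ‖(b' - b) / (z - b)‖ < 1 := by
    intro z hz
    rw [norm_div, div_lt_one ((norm_nonneg _).trans_lt hz)]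
    exact hz
  refine ⟨fun z => Complex.log (1 - (b' - b) / (z - b)), ⟨{z | ‖b' - b‖ < ‖z - b‖}, ?_, ?_, ?_⟩, ?_⟩
  · exact isOpen_lt continuous_const (by fun_prop)
  · intro z hz
    by_contra hcon
    rw [mem_setOf_eq, not_lt] at hcon
    exact h z (hcon.trans_lt hb') hz
  · intro z hz
    have hzb : z - b ≠ 0 := by
      rw [← norm_ne_zero_iff]; exact ((norm_nonneg _).trans_lt hz).ne'
    refine DifferentiableAt.differentiableWithinAt ?_
    refine DifferentiableAt.clog ?_ ?_
    · exact (differentiableAt_const _).sub ((differentiableAt_const _).div (by fun_prop) hzb)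
    · left
      have := hpos z hz
      have h2 := (Complex.abs_re_le_norm ((b' - b) / (z - b))).trans_lt this
      have := (abs_lt.1 h2).2
      simp only [Complex.sub_re, Complex.one_re]
      linarith
  · intro x
    have hx1 : (x:ℂ) - b ≠ 0 := by
      rw [sub_ne_zero]; rintro h'; exact hbD (h' ▸ frontier_subset_closure x.2)
    have hx2 : (x:ℂ) - b' ≠ 0 := by
      rw [sub_ne_zero]; rintro h'; exact hbD' (h' ▸ frontier_subset_closure x.2)
    rw [ContinuousMap.sub_apply, lk_apply hbD, lk_apply hbD', Complex.log_re,
      ← Real.log_div (norm_ne_zero_iff.2 hx2) (norm_ne_zero_iff.2 hx1), ← norm_div]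
    congr 2
    field_simp
    ring

lemma abs_log_sub_log_le {x A η : ℝ} (hA : 0 < A) (hη : 0 ≤ η) (hη' : η ≤ 1 / 2)
    (h : |x - A| ≤ η * A) : |Real.log x - Real.log A| ≤ 2 * η := by
  rw [abs_le] at h
  have hx : A / 2 ≤ x := by nlinarith
  have hx0 : 0 < x := by linarith
  rw [abs_le]
  constructor
  · have h1 := Real.log_le_sub_one_of_pos (x := A / x) (by positivity)
    rw [Real.log_div hA.ne' hx0.ne'] at h1
    have : A / x - 1 ≤ 2 * η := by
      rw [sub_le_iff_le_add, div_le_iff₀ hx0]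
      nlinarith
    linarith
  · have h1 := Real.log_le_sub_one_of_pos (x := x / A) (by positivity)
    rw [Real.log_div hx0.ne' hA.ne'] at h1
    have : x / A - 1 ≤ η := by
      rw [sub_le_iff_le_add, div_le_iff₀ hA]
      nlinarith
    linarith

lemma norm_sub_smul_sq (w n : ℂ) (τ : ℝ) (hn : ‖n‖ = 1) :
    ‖w - τ * n‖ ^ 2 = ‖w‖ ^ 2 - 2 * τ * ip w n + τ ^ 2 := by
  have h1 : n.re * n.re + n.im * n.im = 1 := by
    have := ip_self n
    rw [hn] at this
    simpa [ip] using this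
  rw [← ip_self, ← ip_self]
  simp only [ip, Complex.sub_re, Complex.sub_im, Complex.mul_re, Complex.mul_im, Complex.ofReal_re,
    Complex.ofReal_im]
  linear_combination τ ^ 2 * h1

lemma kernel_close {D : Set ℂ} {ν : ℂ → ℂ} (hν : NormalField D ν) (hD : IsOpen D)
    (hb : IsBounded D) {ε : ℝ} (hε : 0 < ε) :
    ∃ t₁ > 0, ∀ t : ℝ, 0 < t → t ≤ t₁ → ∀ p ∈ frontier D, ∀ ζ ∈ frontier D,
      |1 / 2 * Real.log (‖ζ - p‖ ^ 2 + t ^ 2 * (wt ζ * wt p)) -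
        Real.log ‖ζ - (p + (t * wt p : ℝ) * ν p)‖| ≤ ε := by
  obtain ⟨R₀, hR₀⟩ := hb.closure.exists_norm_le
  set R := max R₀ 1 with hR
  have hRb : ∀ z ∈ frontier D, ‖z‖ ≤ R := fun z hz =>
    (hR₀ z (frontier_subset_closure hz)).trans (le_max_left _ _)
  have hR1 : 1 ≤ R := le_max_right _ _
  set η := min (ε / 2) (1 / 2) with hη
  have hη0 : 0 < η := by positivity
  have hη1 : η ≤ 1 / 2 := min_le_right _ _
  have hη2 : η ≤ ε / 2 := min_le_left _ _
  obtain ⟨l, hl, HT⟩ := hν.tangent hD hη0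
  refine ⟨min (η * l / (2 * (1 + R ^ 2))) (η / R), by positivity, ?_⟩
  intro t ht htle p hp ζ hζ
  have ht1 : t * (2 * (1 + R ^ 2)) ≤ η * l := by
    have := htle.trans (min_le_left _ _)
    rwa [le_div_iff₀ (by positivity)] at this
  have ht2 : t * R ≤ η := by
    have := htle.trans (min_le_right _ _)
    rwa [le_div_iff₀ (by positivity)] at this
  set τ := t * wt p with hτ
  have hwp := wt_pos p
  have hτ0 : 0 < τ := by positivity
  have hτ1 : 2 * τ ≤ η * l := by
    have : wt p ≤ 1 + R ^ 2 := by
      unfold wt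
      have := hRb p hp
      gcongr
    calc 2 * τ = t * (2 * wt p) := by rw [hτ]; ring
      _ ≤ t * (2 * (1 + R ^ 2)) := by gcongr
      _ ≤ _ := ht1
  set d := ‖ζ - p‖ with hd
  have hd0 : 0 ≤ d := norm_nonneg _
  set A := d ^ 2 + τ ^ 2 with hA
  have hA0 : 0 < A := by positivity
  have hu := hν.unit p hp
  have hip : |ip (ζ - p) (ν p)| ≤ d := by
    have := abs_ip_le (ζ - p) (ν p)
    rwa [hu, mul_one] at this
  have hclose1 : |‖ζ - (p + (τ:ℝ) * ν p)‖ ^ 2 - A| ≤ η * A := by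
    have e : ζ - (p + (τ:ℝ) * ν p) = (ζ - p) - τ * ν p := by ring
    rw [e, norm_sub_smul_sq _ _ _ hu]
    have e2 : ‖ζ - p‖ ^ 2 - 2 * τ * ip (ζ - p) (ν p) + τ ^ 2 - A = - (2 * τ * ip (ζ - p) (ν p)) := by
      rw [hA, hd]; ring
    rw [e2, abs_neg, abs_mul, abs_of_pos (by positivity : 0 < 2 * τ)]
    rcases lt_or_ge d l with h | h
    · have h1 := HT p hp ζ hζ h
      rw [← hd] at h1
      calc 2 * τ * |ip (ζ - p) (ν p)| ≤ 2 * τ * (η * d) := by gcongr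
        _ ≤ η * A := by nlinarith [sq_nonneg (d - τ)]
    · calc 2 * τ * |ip (ζ - p) (ν p)| ≤ η * l * d := by gcongr
        _ ≤ η * d * d := by gcongr
        _ ≤ η * A := by nlinarith [sq_nonneg τ]
  have hclose2 : |d ^ 2 + t ^ 2 * (wt ζ * wt p) - A| ≤ η * A := by
    have e2 : d ^ 2 + t ^ 2 * (wt ζ * wt p) - A = τ * t * (wt ζ - wt p) := by
      rw [hA, hτ]; ring
    have h3 : |wt ζ - wt p| ≤ 2 * R * d := by
      have e3 : wt ζ - wt p = (‖ζ‖ + ‖p‖) * (‖ζ‖ - ‖p‖) := by unfold wt; ring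
      rw [e3, abs_mul, abs_of_nonneg (by positivity)]
      have h4 := abs_norm_sub_norm_le ζ p
      have h5 : ‖ζ‖ + ‖p‖ ≤ 2 * R := by linarith [hRb p hp, hRb ζ hζ]
      gcongr
    rw [e2, abs_mul, abs_of_pos (by positivity : 0 < τ * t)]
    calc τ * t * |wt ζ - wt p| ≤ τ * t * (2 * R * d) := by gcongr
      _ = (t * R) * (2 * τ * d) := by ring
      _ ≤ η * (2 * τ * d) := by gcongr
      _ ≤ η * A := by nlinarith [sq_nonneg (d - τ)]
  have k1 := abs_log_sub_log_le hA0 hη0.le hη1 hclose1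
  have k2 := abs_log_sub_log_le hA0 hη0.le hη1 hclose2
  rw [Real.log_pow] at k1
  push_cast at k1
  rw [abs_le] at k1 k2 ⊢
  constructor <;> linarith

theorem exists_dense {D : Set ℂ} {ν : ℂ → ℂ} [CompactSpace (frontier D)] (hν : NormalField D ν)
    (hD : IsOpen D) (hb : IsBounded D) :
    ∃ δ > 0, ∀ l : C(frontier D, ℝ) →L[ℝ] ℝ, (∀ w ∈ reHol D, l w = 0) →
      (∀ c ∈ locConst D δ, l c = 0) → l = 0 := by
  obtain ⟨t₀, ht₀, HB⟩ := hν.exists_radius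
  have hFr : IsCompact (frontier D) := isCompact_iff_compactSpace.2 inferInstance
  have huc := hFr.uniformContinuousOn_of_continuous hν.cont
  obtain ⟨δ₁, hδ₁, Hδ⟩ := Metric.uniformContinuousOn_iff.1 huc (1/8) (by norm_num)
  set δ := min δ₁ (t₀ / 8) with hδ
  refine ⟨δ, by positivity, fun l hN hL => ?_⟩
  -- locally constant potential
  have hU : ∀ (b b' : ℂ) (r : ℝ), (∀ x, ‖x - b‖ < r → x ∉ closure D) → ‖b' - b‖ < r →
      l (lk D b') = l (lk D b) := by
    intro b b' r h1 h2
    have := hN _ (lk_sub_mem h1 h2)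
    rw [map_sub] at this
    linarith
  have hconst : ∀ p ∈ frontier D, ∀ t : ℝ, 0 < t → t ≤ t₀ →
      l (lk D (p + t * ν p)) = l (lk D (p + t₀ * ν p)) := by
    intro p hp t ht htt
    have hu := hν.unit p hp
    have hloc : ∀ s : ℝ, t ≤ s → s ≤ t₀ →
        (fun s' : ℝ => l (lk D (p + s' * ν p))) =ᶠ[nhds s] fun _ => l (lk D (p + s * ν p)) := by
      intro s hs hs'
      filter_upwards [ball_mem_nhds s (by linarith : 0 < s / 4)] with s' hs''
      refine hU _ _ (s / 4) (HB p hp s (by linarith) hs').1 ?_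
      have e : p + s' * ν p - (p + s * ν p) = ((s' - s : ℝ) : ℂ) * ν p := by push_cast; ring
      rw [e, norm_mul, hu, mul_one, Complex.norm_real]
      simpa [Real.dist_eq] using hs''
    have := constant_of_has_deriv_right_zero (f := fun s' : ℝ => l (lk D (p + s' * ν p)))
      (a := t) (b := t₀) ?_ ?_ t₀ ⟨htt, le_rfl⟩
    · exact this.symm
    · intro s hs
      exact (continuousAt_const.congr (hloc s hs.1 hs.2).symm).continuousWithinAt
    · intro s hs
      exact ((hasDerivAt_const s _).congr_of_eventuallyEq
        (hloc s hs.1 hs.2.le)).hasDerivWithinAt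
  have hcl : ∀ p q : frontier D, ‖(p:ℂ) - q‖ < δ →
      l (lk D (p + t₀ * ν p)) = l (lk D (q + t₀ * ν q)) := by
    intro p q hpq
    rw [hδ, lt_min_iff] at hpq
    refine hU _ _ (t₀ / 4) (HB q q.2 t₀ ht₀ le_rfl).1 ?_
    have e : (p:ℂ) + t₀ * ν p - (q + t₀ * ν q) = ((p:ℂ) - q) + t₀ * (ν p - ν q) := by ring
    have h1 := Hδ p p.2 q q.2 (by rw [dist_eq_norm]; exact hpq.1)
    rw [dist_eq_norm] at h1
    rw [e]
    refine (norm_add_le _ _).trans_lt ?_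
    rw [norm_mul, Complex.norm_real, Real.norm_of_nonneg ht₀.le]
    nlinarith [hpq.2]
  set c : C(frontier D, ℝ) := ⟨fun p => l (lk D (p + t₀ * ν p)), by
    rw [Metric.continuous_iff]
    intro p ε hε
    refine ⟨δ, by positivity, fun q hq => ?_⟩
    have : ‖(q:ℂ) - p‖ < δ := by rwa [← dist_eq_norm, ← Subtype.dist_eq]
    rw [hcl q p this]
    simpa using hε⟩ with hc
  have hcm : c ∈ locConst D δ := fun p q h => hcl p q h
  have hc0 : l c = 0 := hL c hcm
  have h1 : l 1 = 0 := hL 1 (fun p q _ => rfl)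
  obtain ⟨R₀, hR₀⟩ := hb.closure.exists_norm_le
  set e : C(frontier D, ℂ) := ⟨fun x => (x:ℂ), continuous_subtype_val⟩ with he
  refine functional_zero_of_kernel e Subtype.val_injective l h1 (fun ε hε => ?_)
  set ε' := ε / (2 * (‖l‖ * ‖l‖ + 1)) with hε'
  have hll : 0 < 2 * (‖l‖ * ‖l‖ + 1) := by positivity
  have hε'0 : 0 < ε' := by positivity
  obtain ⟨t₁, ht₁, HK⟩ := kernel_close hν hD hb hε'0
  refine ⟨min t₁ (t₀ / (1 + R₀ ^ 2)), by positivity, ?_⟩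
  intro t ht htle k hk
  have htR : ∀ p ∈ frontier D, t * wt p ≤ t₀ := by
    intro p hp
    have h2 := htle.trans (min_le_right _ _)
    rw [le_div_iff₀ (by positivity)] at h2
    refine le_trans ?_ h2
    unfold wt
    have := hR₀ p (frontier_subset_closure hp)
    gcongr
  have e2 : biApply l k = l (innerApply l k - (2:ℝ) • c) := by
    rw [map_sub, map_smul, hc0, biApply_apply]; simp
  rw [e2]
  have e3 : ∀ p, |(innerApply l k - (2:ℝ) • c) p| ≤ ‖l‖ * (2 * ε') := by
    intro p
    have hb' : (p:ℂ) + (t * wt p : ℝ) * ν p ∉ closure D :=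
      (HB p p.2 (t * wt p) (mul_pos ht (wt_pos _)) (htR p p.2)).1 _ (by
        have := mul_pos ht (wt_pos (p:ℂ)); simpa using this)
    have e4 : (innerApply l k - (2:ℝ) • c) p
        = l (k.curry p - (2:ℝ) • lk D (p + (t * wt p : ℝ) * ν p)) := by
      rw [map_sub, map_smul, hconst p p.2 (t * wt p) (mul_pos ht (wt_pos _)) (htR p p.2)]
      rfl
    rw [e4]
    refine abs_le_of_bound l _ (by positivity) (fun x => ?_)
    have h5 := HK t ht (htle.trans (min_le_left _ _)) p p.2 x x.2
    have e6 : (k.curry p - (2:ℝ) • lk D (p + (t * wt p : ℝ) * ν p)) x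
        = 2 * (1 / 2 * Real.log (‖(x:ℂ) - p‖ ^ 2 + t ^ 2 * (wt x * wt p)) -
        Real.log ‖(x:ℂ) - (p + (t * wt p : ℝ) * ν p)‖) := by
      rw [ContinuousMap.sub_apply, ContinuousMap.smul_apply, lk_apply hb', ContinuousMap.curry_apply,
        hk, smul_eq_mul]
      simp only [he, ContinuousMap.coe_mk]
      ring
    rw [e6, abs_mul, abs_of_pos (by norm_num : (0:ℝ) < 2)]
    linarith
  refine (abs_le_of_bound l _ (by positivity) e3).trans ?_
  have : ‖l‖ * (‖l‖ * (2 * ε')) = ε * (2 * (‖l‖ * ‖l‖)) / (2 * (‖l‖ * ‖l‖ + 1)) := by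
    rw [hε']; ring
  rw [this, div_le_iff₀ hll]
  nlinarith
end

section


lemma exists_net {D : Set ℂ} (hb : IsBounded D) {δ : ℝ} (hδ : 0 < δ) :
    ∃ S : Finset (frontier D), ∀ x : frontier D, ∃ s ∈ S, ‖(x:ℂ) - s‖ < δ := by
  have hc : IsCompact (frontier D) := by
    refine Metric.isCompact_of_isClosed_isBounded isClosed_frontier ?_
    exact hb.closure.subset frontier_subset_closure
  haveI : CompactSpace (frontier D) := isCompact_iff_compactSpace.1 hc
  obtain ⟨t, -, ht, hcov⟩ := (isCompact_univ (X := frontier D)).finite_cover_balls hδ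
  refine ⟨ht.toFinset, fun x => ?_⟩
  have := hcov (mem_univ x)
  simp only [mem_iUnion, mem_ball, exists_prop] at this
  obtain ⟨s, hs, hd⟩ := this
  refine ⟨s, by simpa using hs, ?_⟩
  rwa [Subtype.dist_eq, dist_eq_norm] at hd

lemma locConst_finite {D : Set ℂ} (hb : IsBounded D) {δ : ℝ} (hδ : 0 < δ) :
    FiniteDimensional ℝ (locConst D δ) := by
  obtain ⟨S, hS⟩ := exists_net hb hδ
  let f : locConst D δ →ₗ[ℝ] (S → ℝ) :=
    { toFun := fun c s => c.1 s.1
      map_add' := fun a b => rfl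
      map_smul' := fun a b => rfl }
  refine FiniteDimensional.of_injective f ?_
  intro a b hab
  apply Subtype.ext
  ext x
  obtain ⟨s, hs, hd⟩ := hS x
  rw [a.2 x s hd, b.2 x s hd]
  exact congrFun hab ⟨s, hs⟩

lemma decomposition {D : Set ℂ} {ν : ℂ → ℂ} [CompactSpace (frontier D)] (hν : NormalField D ν)
    (hD : IsOpen D) (hb : IsBounded D) : ∃ δ > 0, ∀ f : C(frontier D, ℝ),
      ∃ w ∈ (reHol D).topologicalClosure, ∃ c ∈ locConst D δ, f = w + c := by
  obtain ⟨δ, hδ, h⟩ := exists_dense hν hD hb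
  refine ⟨δ, hδ, fun f => ?_⟩
  haveI := locConst_finite hb hδ
  set M := (reHol D).topologicalClosure ⊔ locConst D δ with hM
  have hcl : IsClosed (M : Set C(frontier D, ℝ)) :=
    Submodule.isClosed_sup_finiteDimensional _ _ (reHol D).isClosed_topologicalClosure
  have hf : f ∈ M := by
    by_contra hf
    obtain ⟨l, u, h1, h2⟩ := geometric_hahn_banach_closed_point M.convex hcl hf
    have h0 : ∀ a ∈ M, l a = 0 := by
      intro a ha
      by_contra hne
      have := h1 _ (M.smul_mem ((u + 1) / l a) ha)
      rw [map_smul, smul_eq_mul, div_mul_cancel₀ _ hne] at this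
      linarith
    have hl := h l (fun w hw => h0 w (Submodule.mem_sup_left
      ((reHol D).le_topologicalClosure hw))) (fun c hc => h0 c (Submodule.mem_sup_right hc))
    have := h1 0 M.zero_mem
    rw [hl] at this h2
    simp at this h2
    linarith
  obtain ⟨w, hw, c, hc, e⟩ := Submodule.mem_sup.1 hf
  exact ⟨w, hw, c, hc, e.symm⟩

end

section


lemma HolNear.re_le {D : Set ℂ} {f : ℂ → ℂ} (hb : IsBounded D) (hf : HolNear D f) {ε : ℝ}
    (h : ∀ x ∈ frontier D, (f x).re ≤ ε) : ∀ z ∈ closure D, (f z).re ≤ ε := by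
  intro z hz
  have hd : DiffContOnCl ℂ (fun z => Complex.exp (f z)) D :=
    ⟨hf.differentiableOn.cexp, hf.continuousOn.cexp⟩
  have := Complex.norm_le_of_forall_mem_frontier_norm_le hb hd (C := Real.exp ε)
    (fun x hx => by rw [Complex.norm_exp]; exact Real.exp_le_exp.2 (h x hx)) hz
  rw [Complex.norm_exp] at this
  exact Real.exp_le_exp.1 this

lemma HolNear.abs_re_le {D : Set ℂ} {f : ℂ → ℂ} (hb : IsBounded D) (hf : HolNear D f) {ε : ℝ}
    (h : ∀ x ∈ frontier D, |(f x).re| ≤ ε) : ∀ z ∈ closure D, |(f z).re| ≤ ε := by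
  intro z hz
  rw [abs_le]
  constructor
  · have hn : HolNear D (fun z => (-1) * f z) := (HolNear.const (-1)).mul hf
    have := hn.re_le hb (ε := ε) (fun x hx => by
      have := (abs_le.1 (h x hx)).1
      simp; linarith) z hz
    simp at this
    linarith
  · exact hf.re_le hb (fun x hx => (abs_le.1 (h x hx)).2) z hz

lemma deriv_bound {f : ℂ → ℂ} {z : ℂ} {r ε : ℝ} (hr : 0 < r) (hε : 0 < ε) {D : Set ℂ}
    (hD : IsOpen D) (hf : DifferentiableOn ℂ f D) (hs : closedBall z r ⊆ D)
    (h : ∀ x ∈ D, |(f x).re| ≤ ε) : ‖deriv f z‖ ≤ ε * (Real.exp 2 / r) := by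
  have hzD : z ∈ D := hs (mem_closedBall_self hr.le)
  have hfz : DifferentiableAt ℂ f z := (hf z hzD).differentiableAt (hD.mem_nhds hzD)
  have hg : DifferentiableOn ℂ (fun x => Complex.exp (f x * ((ε⁻¹ : ℝ):ℂ))) D :=
    (hf.mul_const _).cexp
  have hgre : ∀ x ∈ D, |(f x * ((ε⁻¹ : ℝ):ℂ)).re| ≤ 1 := by
    intro x hx
    rw [Complex.re_mul_ofReal, abs_mul, abs_of_pos (inv_pos.2 hε), ← div_eq_mul_inv,
      div_le_one hε]
    exact h x hx
  have hd : DiffContOnCl ℂ (fun x => Complex.exp (f x * ((ε⁻¹ : ℝ):ℂ))) (ball z r) :=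
    (hg.mono hs).diffContOnCl_ball Subset.rfl
  have h1 := Complex.norm_deriv_le_of_forall_mem_sphere_norm_le hr hd (C := Real.exp 1)
    (fun x hx => by
      rw [Complex.norm_exp]
      exact Real.exp_le_exp.2 (abs_le.1 (hgre x (hs (sphere_subset_closedBall hx)))).2)
  have h2 : HasDerivAt (fun x => Complex.exp (f x * ((ε⁻¹ : ℝ):ℂ)))
      (Complex.exp (f z * ((ε⁻¹ : ℝ):ℂ)) * (deriv f z * ((ε⁻¹ : ℝ):ℂ))) z :=
    (hfz.hasDerivAt.mul_const _).cexp
  rw [h2.deriv, norm_mul, norm_mul, Complex.norm_exp, Complex.norm_real, Real.norm_eq_abs,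
    abs_of_pos (inv_pos.2 hε)] at h1
  have h3 : Real.exp (-1) ≤ Real.exp (f z * ((ε⁻¹ : ℝ):ℂ)).re :=
    Real.exp_le_exp.2 (abs_le.1 (hgre z hzD)).1
  have h4 : Real.exp (-1) * (‖deriv f z‖ * ε⁻¹) ≤ Real.exp 1 / r :=
    (mul_le_mul_of_nonneg_right h3 (by positivity)).trans h1
  have e2 : Real.exp 2 = Real.exp 1 * Real.exp 1 := by rw [← Real.exp_add]; norm_num
  have e3 : Real.exp 1 * Real.exp (-1) = 1 := by rw [← Real.exp_add]; simp
  calc ‖deriv f z‖ = ε * Real.exp 1 * (Real.exp (-1) * (‖deriv f z‖ * ε⁻¹)) := by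
        have : ε * ε⁻¹ = 1 := mul_inv_cancel₀ hε.ne'
        linear_combination (-(‖deriv f z‖ * (ε * ε⁻¹))) * e3 - ‖deriv f z‖ * this
    _ ≤ ε * Real.exp 1 * (Real.exp 1 / r) := by gcongr
    _ = _ := by rw [e2]; ring

/-- `c ↦ (v ↦ Re (c v))`. -/
def reL : ℂ →L[ℝ] (ℂ →L[ℝ] ℝ) :=
  (ContinuousLinearMap.compL ℝ ℂ ℂ ℝ Complex.reCLM).comp (ContinuousLinearMap.mul ℝ ℂ)

@[simp] lemma reL_apply (c v : ℂ) : reL c v = (c * v).re := rfl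

lemma hasFDerivAt_re {f : ℂ → ℂ} {f' z : ℂ} (h : HasDerivAt f f' z) :
    HasFDerivAt (fun z => (f z).re) (reL f') z := by
  have h1 := (Complex.reCLM.hasFDerivAt (x := f z)).comp z (h.hasFDerivAt.restrictScalars ℝ)
  refine h1.congr_fderiv ?_
  ext v
  simp
  ring

/-- The harmonic extension data of a boundary function in the closure of `reHol D`. -/
structure HarmExt (D : Set ℂ) (w : C(frontier D, ℝ)) (W : ℂ → ℝ) (W' : ℂ → ℂ) : Prop where
  cont : ContinuousOn W (closure D)
  bd : ∀ x : frontier D, W x = w x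
  hol : DifferentiableOn ℂ W' D
  deriv : ∀ z ∈ D, HasFDerivAt W (reL (W' z)) z
  approx : ∀ a ∈ D, ∀ ε > 0, ∃ G, HolNear D G ∧
    ∀ x : frontier D, |w x - W a - (((x:ℂ) - a) * G x).re| ≤ ε

lemma exists_harmExt {D : Set ℂ} [CompactSpace (frontier D)] (hD : IsOpen D) (hb : IsBounded D)
    {w : C(frontier D, ℝ)} (hw : w ∈ (reHol D).topologicalClosure) :
    ∃ W W', HarmExt D w W W' := by
  have h0 : ∀ n : ℕ, ∃ A, HolNear D A ∧ ∀ x : frontier D, |w x - (A x).re| ≤ 1 / (n + 1 : ℝ) := by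
    intro n
    have hw' : w ∈ closure ((reHol D : Submodule ℝ C(frontier D, ℝ)) : Set C(frontier D, ℝ)) := hw
    obtain ⟨v, ⟨A, hA, hv⟩, hd⟩ := Metric.mem_closure_iff.1 hw' (1 / (n + 1 : ℝ)) (by positivity)
    refine ⟨A, hA, fun x => ?_⟩
    rw [← hv x, ← Real.dist_eq]
    exact (ContinuousMap.dist_apply_le_dist x).trans hd.le
  choose A hA hAw using h0
  have hsmall : ∀ η > 0, ∃ N : ℕ, ∀ n ≥ N, 1 / (n + 1 : ℝ) < η := by
    intro η hη
    obtain ⟨N, hN⟩ := exists_nat_one_div_lt hη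
    refine ⟨N, fun n hn => lt_of_le_of_lt ?_ hN⟩
    gcongr
  have hcau : ∀ η > 0, ∃ N : ℕ, ∀ m ≥ N, ∀ n ≥ N, ∀ z ∈ closure D,
      |(A m z - A n z).re| ≤ η := by
    intro η hη
    obtain ⟨N, hN⟩ := hsmall (η / 2) (by positivity)
    refine ⟨N, fun m hm n hn => ((hA m).sub (hA n)).abs_re_le hb ?_⟩
    intro x hx
    have h1 := (hAw m ⟨x, hx⟩).trans (hN m hm).le
    have h2 := (hAw n ⟨x, hx⟩).trans (hN n hn).le
    simp only [Complex.sub_re]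
    rw [abs_le] at *
    constructor <;> linarith
  have hU : UniformCauchySeqOn (fun n z => (A n z).re) Filter.atTop (closure D) := by
    rw [Metric.uniformCauchySeqOn_iff]
    intro ε hε
    obtain ⟨N, hN⟩ := hcau (ε / 2) (by positivity)
    refine ⟨N, fun m hm n hn z hz => ?_⟩
    rw [Real.dist_eq, ← Complex.sub_re]
    linarith [hN m hm n hn z hz]
  have hlim : ∀ z, ∃ W, z ∈ closure D → Filter.Tendsto (fun n => (A n z).re) Filter.atTop (nhds W) := by
    intro z
    by_cases hz : z ∈ closure D
    · obtain ⟨W, hW⟩ := cauchySeq_tendsto_of_complete (hU.cauchySeq hz)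
      exact ⟨W, fun _ => hW⟩
    · exact ⟨0, fun h => absurd h hz⟩
  choose W hW using hlim
  have hUW : TendstoUniformlyOn (fun n z => (A n z).re) W Filter.atTop (closure D) :=
    hU.tendstoUniformlyOn_of_tendsto hW
  have hV : ∀ z ∈ D, ∃ r > 0, ball z r ⊆ D ∧
      UniformCauchySeqOn (fun n z => deriv (A n) z) Filter.atTop (ball z r) := by
    intro z hz
    obtain ⟨R, hR, hsub⟩ := Metric.isOpen_iff.1 hD z hz
    refine ⟨R / 2, by positivity, (ball_subset_ball (by linarith)).trans hsub, ?_⟩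
    rw [Metric.uniformCauchySeqOn_iff]
    intro ε hε
    set η := ε / (2 * (Real.exp 2 / (R / 4))) with hη
    have hηp : 0 < η := by positivity
    obtain ⟨N, hN⟩ := hcau η hηp
    refine ⟨N, fun m hm n hn y hy => ?_⟩
    have hs : closedBall y (R / 4) ⊆ D := by
      intro x hx
      apply hsub
      rw [mem_ball] at *
      rw [mem_closedBall] at hx
      have := dist_triangle x y z
      linarith
    have hyD : y ∈ D := hs (mem_closedBall_self (by positivity))
    have hb' := deriv_bound (by positivity) hηp hD ((hA m).sub (hA n)).differentiableOn hs
      (fun x hx => hN m hm n hn x (subset_closure hx))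
    have hm' : DifferentiableAt ℂ (A m) y := ((hA m).differentiableOn y hyD).differentiableAt
      (hD.mem_nhds hyD)
    have hn' : DifferentiableAt ℂ (A n) y := ((hA n).differentiableOn y hyD).differentiableAt
      (hD.mem_nhds hyD)
    rw [(hm'.hasDerivAt.fun_sub hn'.hasDerivAt).deriv] at hb'
    rw [dist_eq_norm]
    have : η * (Real.exp 2 / (R / 4)) = ε / 2 := by
      rw [hη]; field_simp
    linarith
  have hlim' : ∀ z, ∃ W', z ∈ D → Filter.Tendsto (fun n => deriv (A n) z) Filter.atTop (nhds W') := by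
    intro z
    by_cases hz : z ∈ D
    · obtain ⟨r, hr, -, h⟩ := hV z hz
      obtain ⟨W, hW⟩ := cauchySeq_tendsto_of_complete (h.cauchySeq (mem_ball_self hr))
      exact ⟨W, fun _ => hW⟩
    · exact ⟨0, fun h => absurd h hz⟩
  choose W' hW' using hlim'
  have hL : TendstoLocallyUniformlyOn (fun n z => deriv (A n) z) W' Filter.atTop D := by
    refine tendstoLocallyUniformlyOn_of_forall_exists_nhds (fun z hz => ?_)
    obtain ⟨r, hr, hs, h⟩ := hV z hz
    exact ⟨ball z r, mem_nhdsWithin_of_mem_nhds (ball_mem_nhds z hr),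
      h.tendstoUniformlyOn_of_tendsto (fun x hx => hW' x (hs hx))⟩
  have hbdW : ∀ x : frontier D, W x = w x := by
    intro x
    refine tendsto_nhds_unique (hW x (frontier_subset_closure x.2)) ?_
    rw [Metric.tendsto_atTop]
    intro ε hε
    obtain ⟨N, hN⟩ := hsmall ε hε
    refine ⟨N, fun n hn => ?_⟩
    rw [dist_comm, Real.dist_eq]
    exact (hAw n x).trans_lt (hN n hn)
  refine ⟨W, W', ?_, hbdW, ?_, ?_, ?_⟩
  · exact hUW.continuousOn (Filter.Frequently.of_forall fun n =>
      Complex.continuous_re.comp_continuousOn (hA n).continuousOn)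
  · exact hL.differentiableOn (Filter.Eventually.of_forall fun n =>
      (hA n).differentiableOn.deriv hD) hD
  · intro z hz
    refine hasFDerivAt_of_tendstoLocallyUniformlyOn hD
      (reL.uniformContinuous.comp_tendstoLocallyUniformlyOn hL)
      (fun n x hx => hasFDerivAt_re
        (((hA n).differentiableOn x hx).differentiableAt (hD.mem_nhds hx)).hasDerivAt)
      (fun x hx => hW x (subset_closure hx)) hz
  · intro a ha ε hε
    obtain ⟨N, hN⟩ := hsmall (ε / 2) (by positivity)
    have h1 := Metric.tendsto_atTop.1 (hW a (subset_closure ha)) (ε / 2) (by positivity)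
    obtain ⟨N', hN'⟩ := h1
    set n := max N N'
    refine ⟨dslope (A n) a, ?_, fun x => ?_⟩
    · obtain ⟨U, hU, hDU, h⟩ := hA n
      exact ⟨U, hU, hDU, (Complex.differentiableOn_dslope
        (hU.mem_nhds (hDU (subset_closure ha)))).2 h⟩
    · have e := sub_smul_dslope (A n) a x
      rw [smul_eq_mul] at e
      rw [e]
      have h2 := (hAw n x).trans (hN n (le_max_left _ _)).le
      have h3 := hN' n (le_max_right _ _)
      rw [Real.dist_eq] at h3
      have h3 := h3.le
      rw [Complex.sub_re]
      rw [abs_le] at *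
      constructor <;> linarith

end

section


lemma exists_avoid (T : Finset ℂ) (hT : ∀ q ∈ T, q ≠ 0) :
    ∃ e : ℂ, e ≠ 0 ∧ ∀ q ∈ T, (e * q).re ≠ 0 := by
  classical
  obtain ⟨t, ht⟩ := Infinite.exists_notMem_finset (T.image fun q => q.re / q.im)
  refine ⟨⟨1, t⟩, ?_, ?_⟩
  · intro h
    have := congrArg Complex.re h
    simp at this
  · intro q hq h
    simp only [Complex.mul_re, one_mul] at h
    by_cases hi : q.im = 0
    · apply hT q hq
      rw [hi] at h
      apply Complex.ext
      · simpa using h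
      · simpa using hi
    · apply ht
      refine Finset.mem_image.2 ⟨q, hq, ?_⟩
      rw [div_eq_iff hi]
      linarith

lemma neg_degree_false {𝒟 : BrouwerDegreeTheory ℂ} {D : Set ℂ} {Φ : ℂ → ℂ} (h : DegHyp 𝒟 D Φ)
    (hD : IsOpen D) (hb : IsBounded D) (hΦ : ContinuousOn Φ (frontier D)) {a e : ℂ} (ha : a ∈ D)
    (he : e ≠ 0) {G : ℂ → ℂ} (hG : HolNear D G)
    (hre : ∀ x ∈ frontier D, ((x - a) * (e * Φ x - G x)).re ≠ 0) : False := by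
  obtain ⟨Ψ, hΨ, hΨe⟩ := tietze_complex isClosed_frontier hΦ
  have hG2 := (HolNear.const (D := D) (-e⁻¹)).mul hG
  have hfac : ∀ z, e * (Φ z + -e⁻¹ * G z) = e * Φ z - G z := by
    intro z; field_simp; ring
  have hG3 := hG2
  obtain ⟨U, hU, hDU, hd⟩ := hG2
  have hc : ContinuousOn (fun z => Ψ z + -e⁻¹ * G z) (closure D) :=
    hΨ.continuousOn.add hG3.continuousOn
  have h1 := h U _ hU hDU hd (by
    intro z hz h0
    apply hre z hz
    rw [← hfac, h0]
    simp) (fun z => Ψ z + -e⁻¹ * G z) hc (by intro z hz; simp only [hΨe z hz])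
  have h2 := 𝒟.deg_linear hD hb hc (F₁ := fun z => (Complex.I * e⁻¹) * (starRingEnd ℂ (z - a)))
    (Continuous.continuousOn (by fun_prop)) (by
      intro x hx s hs0 hs1 h0
      simp only [hΨe x hx] at h0
      have hxa : x - a ≠ 0 := by
        rw [sub_ne_zero]
        rintro rfl
        rw [hD.frontier_eq] at hx
        exact hx.2 ha
      have h3 : ((1 - s : ℝ) : ℂ) * ((x - a) * (e * Φ x - G x))
          + (s : ℂ) * (Complex.I * ((Complex.normSq (x - a) : ℝ) : ℂ)) = 0 := by
        rw [← hfac, ← Complex.mul_conj]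
        have : (x - a) * e * (((1 - s : ℝ) : ℂ) * (Φ x + -e⁻¹ * G x) +
          (s : ℂ) * (Complex.I * e⁻¹ * (starRingEnd ℂ) (x - a))) = 0 := by rw [h0, mul_zero]
        rw [← this]
        field_simp
      have h4 := congrArg Complex.re h3
      have h5 := congrArg Complex.im h3
      rw [Complex.add_re, Complex.re_ofReal_mul, Complex.re_ofReal_mul] at h4
      rw [Complex.add_im, Complex.im_ofReal_mul, Complex.im_ofReal_mul] at h5
      simp only [Complex.I_mul_re, Complex.I_mul_im, Complex.ofReal_re, Complex.ofReal_im,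
        Complex.zero_re, Complex.zero_im, neg_zero, mul_zero, add_zero] at h4 h5
      rcases mul_eq_zero.1 h4 with h6 | h6
      · rw [h6, zero_mul, zero_add] at h5
        have : s = 1 := by linarith
        rw [this, one_mul] at h5
        exact hxa (Complex.normSq_eq_zero.1 h5)
      · exact hre x hx h6)
  rw [𝒟.deg_conj (mul_ne_zero Complex.I_ne_zero (inv_ne_zero he)) hD hb ha] at h2
  rw [h2] at h1
  norm_num at h1

/-- Decomposition of a continuous complex function on the boundary. -/
structure CExt (D : Set ℂ) (δ : ℝ) (f h : ℂ → ℂ) (c : frontier D → ℂ) (Y : ℂ → ℂ) : Prop where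
  cont : ContinuousOn h (closure D)
  bd : ∀ x : frontier D, f x = h x + c x
  lc : ∀ p q : frontier D, ‖(p:ℂ) - q‖ < δ → c p = c q
  hol : DifferentiableOn ℂ Y D
  deriv : ∀ z ∈ D, ∃ (Z : ℂ) (A : ℂ →L[ℝ] ℂ), HasFDerivAt h A z ∧
    ∀ v, A v = Z * v + starRingEnd ℂ (Y z * v)
  approx : ∀ a ∈ D, ∀ β : ℂ, ∀ ε > 0, ∃ G, HolNear D G ∧
    ∀ x : frontier D, |(β * (h x - h a)).re - (((x:ℂ) - a) * G x).re| ≤ ε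

lemma exists_cext {D : Set ℂ} {ν : ℂ → ℂ} [CompactSpace (frontier D)] (hν : NormalField D ν)
    (hD : IsOpen D) (hb : IsBounded D) : ∃ δ > 0, ∀ f : ℂ → ℂ, ContinuousOn f (frontier D) →
      ∃ h c Y, CExt D δ f h c Y := by
  obtain ⟨δ, hδ, hdec⟩ := decomposition hν hD hb
  refine ⟨δ, hδ, fun f hf => ?_⟩
  have hf' : Continuous (fun x : frontier D => f x) := continuousOn_iff_continuous_domRestrict.1 hf
  obtain ⟨w, hw, c, hc, e⟩ := hdec ⟨fun x => (f x).re, Complex.continuous_re.comp hf'⟩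
  obtain ⟨w₂, hw₂, c₂, hc₂, e₂⟩ := hdec ⟨fun x => (f x).im, Complex.continuous_im.comp hf'⟩
  obtain ⟨W, A, hW⟩ := exists_harmExt hD hb hw
  obtain ⟨W₂, B, hW₂⟩ := exists_harmExt hD hb hw₂
  have e' : ∀ x : frontier D, (f x).re = w x + c x := fun x => DFunLike.congr_fun e x
  have e₂' : ∀ x : frontier D, (f x).im = w₂ x + c₂ x := fun x => DFunLike.congr_fun e₂ x
  refine ⟨fun z => ⟨W z, W₂ z⟩, fun x => ⟨c x, c₂ x⟩, fun z => (A z - Complex.I * B z) / 2,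
    ?_, ?_, ?_, ?_, ?_, ?_⟩
  · have : (fun z => (⟨W z, W₂ z⟩ : ℂ)) = fun z => (W z : ℂ) + W₂ z * Complex.I := by
      funext z; exact Complex.mk_eq_add_mul_I _ _
    rw [this]
    exact (Complex.continuous_ofReal.comp_continuousOn hW.cont).add
      ((Complex.continuous_ofReal.comp_continuousOn hW₂.cont).mul continuousOn_const)
  · intro x
    apply Complex.ext
    · simp [e', hW.bd]
    · simp [e₂', hW₂.bd]
  · intro p q hpq
    simp only [hc p q hpq, hc₂ p q hpq]
  · exact (hW.hol.sub (hW₂.hol.const_mul _)).div_const _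
  · intro z hz
    refine ⟨(A z + Complex.I * B z) / 2, Complex.ofRealCLM.comp (reL (A z)) +
      Complex.I • Complex.ofRealCLM.comp (reL (B z)), ?_, ?_⟩
    · have : (fun z => (⟨W z, W₂ z⟩ : ℂ)) = fun z => (W z : ℂ) + Complex.I • (W₂ z : ℂ) := by
        funext z; rw [smul_eq_mul, mul_comm]; exact Complex.mk_eq_add_mul_I _ _
      rw [this]
      exact ((Complex.ofRealCLM.hasFDerivAt (x := W z)).comp z (hW.deriv z hz)).add
        (((Complex.ofRealCLM.hasFDerivAt (x := W₂ z)).comp z (hW₂.deriv z hz)).const_smul Complex.I)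
    · intro v
      have h2 : (2:ℂ)⁻¹ = ((2⁻¹ : ℝ) : ℂ) := by simp
      simp only [div_eq_mul_inv, h2]
      apply Complex.ext <;> simp <;> ring
  · intro a ha β ε hε
    set M := |β.re| + |β.im| + 1 with hM
    have hMp : 0 < M := by positivity
    obtain ⟨G, hG, hGa⟩ := hW.approx a ha (ε / M) (by positivity)
    obtain ⟨G₂, hG₂, hGa₂⟩ := hW₂.approx a ha (ε / M) (by positivity)
    refine ⟨_, ((HolNear.const (β.re : ℂ)).mul hG).sub ((HolNear.const (β.im : ℂ)).mul hG₂),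
      fun x => ?_⟩
    have h1 := hGa x
    have h2 := hGa₂ x
    rw [← hW.bd x] at h1
    rw [← hW₂.bd x] at h2
    have key : (β * ((⟨W x, W₂ x⟩ : ℂ) - ⟨W a, W₂ a⟩)).re -
        (((x:ℂ) - a) * ((β.re : ℂ) * G x - (β.im : ℂ) * G₂ x)).re =
        β.re * (W x - W a - (((x:ℂ) - a) * G x).re) -
        β.im * (W₂ x - W₂ a - (((x:ℂ) - a) * G₂ x).re) := by
      simp
      ring
    refine (congrArg abs key).trans_le ?_
    calc _ ≤ |β.re * (W x - W a - (((x:ℂ) - a) * G x).re)| +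
        |β.im * (W₂ x - W₂ a - (((x:ℂ) - a) * G₂ x).re)| := abs_sub _ _
      _ ≤ |β.re| * (ε / M) + |β.im| * (ε / M) := by
        rw [abs_mul, abs_mul]; gcongr
      _ ≤ M * (ε / M) := by
        rw [← add_mul]; gcongr; rw [hM]; linarith
      _ = ε := by field_simp

lemma not_diff_conj (a : ℂ) : ¬ DifferentiableAt ℂ (fun z => starRingEnd ℂ z) a := by
  intro h
  have h1 := h.hasDerivAt.hasFDerivAt.restrictScalars ℝ
  have h2 : HasFDerivAt (fun z => starRingEnd ℂ z) (Complex.conjCLE : ℂ →L[ℝ] ℂ) a :=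
    Complex.conjCLE.hasFDerivAt
  have h3 := h1.unique h2
  have h4 := DFunLike.congr_fun h3 1
  have h5 := DFunLike.congr_fun h3 Complex.I
  simp at h4 h5
  rw [h4] at h5
  have := congrArg Complex.im h5
  norm_num at this

lemma conj_relation {ω : Set ℂ} (hω : IsOpen ω) {Y₀ Y₁ : ℂ → ℂ} (h₀ : DifferentiableOn ℂ Y₀ ω)
    (h₁ : DifferentiableOn ℂ Y₁ ω) (h : ∀ z ∈ ω, Y₁ z = starRingEnd ℂ z * Y₀ z) :
    ∀ z ∈ ω, Y₀ z = 0 := by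
  intro a ha
  by_contra hne
  have hd₀ := (h₀ a ha).differentiableAt (hω.mem_nhds ha)
  have hd₁ := (h₁ a ha).differentiableAt (hω.mem_nhds ha)
  apply not_diff_conj a
  refine (hd₁.div hd₀ hne).congr_of_eventuallyEq ?_
  filter_upwards [hω.mem_nhds ha, hd₀.continuousAt.eventually_ne hne] with z hz hz0
  simp only [Pi.div_apply]
  rw [h z hz, mul_div_assoc, div_self hz0, mul_one]

lemma not_isolated {D : Set ℂ} {ν : ℂ → ℂ} (hν : NormalField D ν) (hD : IsOpen D)
    {δ : ℝ} (hδ : 0 < δ) (p : ℂ) (hp : p ∈ frontier D) :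
    ∃ q ∈ frontier D, q ≠ p ∧ ‖p - q‖ < δ := by
  obtain ⟨t₀, ht₀, h⟩ := hν.exists_radius
  set t := min t₀ (δ / 2) with ht
  have htp : 0 < t := lt_min ht₀ (by positivity)
  have htδ : t < δ := (min_le_right _ _).trans_lt (by linarith)
  obtain ⟨h1, h2⟩ := h p hp t htp (min_le_left _ _)
  have h1' := h1 (p + t * ν p) (by simpa using htp)
  have h2' := h2 (p - t * ν p) (by simpa using htp)
  by_contra hcon
  push Not at hcon
  have hs : IsPreconnected (sphere p t) :=
    isPreconnected_sphere (by rw [Complex.rank_real_complex]; norm_num) p t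
  have hsub := preconnected_subset_of_frontier hs hD
    ⟨p - t * ν p, by simp [hν.unit p hp, htp.le], h2'⟩ (by
      intro y hy hyf
      rw [mem_sphere, dist_eq_norm] at hy
      have := hcon y hyf (by rintro rfl; simp at hy; exact htp.ne hy)
      rw [norm_sub_rev, hy] at this
      linarith)
  exact h1' (subset_closure (hsub (by simp [hν.unit p hp, htp.le])))

end

section


/-- For every interior point some boundary piece is bad. -/
lemma exists_bad {𝒟 : BrouwerDegreeTheory ℂ} {D : Set ℂ} {Φ : ℂ → ℂ} (hdeg : DegHyp 𝒟 D Φ)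
    (hD : IsOpen D) (hb : IsBounded D) (hΦ : ContinuousOn Φ (frontier D)) {δ : ℝ}
    {h₀ h₁ : ℂ → ℂ} {c₀ c₁ : frontier D → ℂ} {Y₀ Y₁ : ℂ → ℂ} (hC₀ : CExt D δ Φ h₀ c₀ Y₀)
    (hC₁ : CExt D δ (fun z => z * Φ z) h₁ c₁ Y₁) (S : Finset (frontier D))
    (hS : ∀ x : frontier D, ∃ s ∈ S, ‖(x:ℂ) - s‖ < δ) {a : ℂ} (ha : a ∈ D) :
    ∃ s ∈ S, h₁ a + c₁ s = a * (h₀ a + c₀ s) := by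
  classical
  by_contra hcon
  push Not at hcon
  set q : frontier D → ℂ := fun s => (h₁ a + c₁ s) - a * (h₀ a + c₀ s) with hq
  obtain ⟨e, he, heq⟩ := exists_avoid (S.image q) (by
    intro y hy
    obtain ⟨s, hs, rfl⟩ := Finset.mem_image.1 hy
    exact sub_ne_zero.2 (hcon s hs))
  have hm : ∃ m > 0, ∀ s ∈ S, m ≤ |(e * q s).re| := by
    rcases S.eq_empty_or_nonempty with h | h
    · exact ⟨1, one_pos, by simp [h]⟩
    · obtain ⟨s, hs, hmin⟩ := S.exists_min_image (fun s => |(e * q s).re|) h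
      exact ⟨_, abs_pos.2 (heq _ (Finset.mem_image_of_mem q hs)), hmin⟩
  obtain ⟨m, hm0, hm⟩ := hm
  obtain ⟨G₁, hG₁, ha₁⟩ := hC₁.approx a ha e (m / 4) (by positivity)
  obtain ⟨G₀, hG₀, ha₀⟩ := hC₀.approx a ha (e * a) (m / 4) (by positivity)
  refine neg_degree_false hdeg hD hb hΦ ha he (hG₁.sub hG₀) ?_
  intro x hx h0
  obtain ⟨s, hs, hd⟩ := hS ⟨x, hx⟩
  have hqx : q ⟨x, hx⟩ = q s := by
    simp only [hq, hC₀.lc _ _ hd, hC₁.lc _ _ hd]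
  have e₀ : Φ x = h₀ x + c₀ ⟨x, hx⟩ := hC₀.bd ⟨x, hx⟩
  have e₁ : x * Φ x = h₁ x + c₁ ⟨x, hx⟩ := hC₁.bd ⟨x, hx⟩
  have i₁ := ha₁ ⟨x, hx⟩
  have i₀ := ha₀ ⟨x, hx⟩
  have key : (x - a) * (e * Φ x - (G₁ x - G₀ x)) =
      e * q s + (e * (h₁ x - h₁ a) - (x - a) * G₁ x) - (e * a * (h₀ x - h₀ a) - (x - a) * G₀ x) := by
    rw [← hqx]
    simp only [hq]
    linear_combination e * e₁ - e * a * e₀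
  rw [key] at h0
  simp only [Complex.add_re, Complex.sub_re] at h0 i₁ i₀
  have hms := hm s hs
  simp only [abs_le] at i₁ i₀
  rw [le_abs] at hms
  rcases hms with h | h <;> linarith [i₁.1, i₁.2, i₀.1, i₀.2]

lemma CExt.hol_of_zero {D : Set ℂ} {δ : ℝ} {f h : ℂ → ℂ} {c : frontier D → ℂ} {Y : ℂ → ℂ}
    (hC : CExt D δ f h c Y) (hY : ∀ z ∈ D, Y z = 0) : DifferentiableOn ℂ h D := by
  intro z hz
  obtain ⟨Z, A, hA, hv⟩ := hC.deriv z hz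
  have : HasFDerivAt h (ContinuousLinearMap.toSpanSingleton ℂ Z) z := by
    refine hasFDerivAt_of_restrictScalars ℝ hA ?_
    ext v
    simp [hv, hY z hz, mul_comm]
  exact this.differentiableAt.differentiableWithinAt

theorem connected_case {𝒟 : BrouwerDegreeTheory ℂ} {D : Set ℂ} {Φ ν : ℂ → ℂ}
    (hdeg : DegHyp 𝒟 D Φ) (hν : NormalField D ν)
    (hD : IsOpen D) (hb : IsBounded D) (hcon : IsPreconnected D) (hne : D.Nonempty)
    (hΦ : ContinuousOn Φ (frontier D)) : ExtendsHolomorphically Φ D := by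
  have hcpt : IsCompact (frontier D) :=
    Metric.isCompact_of_isClosed_isBounded isClosed_frontier
      (hb.closure.subset frontier_subset_closure)
  have : CompactSpace (frontier D) := isCompact_iff_compactSpace.1 hcpt
  obtain ⟨δ, hδ, hext⟩ := exists_cext hν hD hb
  obtain ⟨h₀, c₀, Y₀, hC₀⟩ := hext Φ hΦ
  obtain ⟨h₁, c₁, Y₁, hC₁⟩ := hext (fun z => z * Φ z) (continuousOn_id.mul hΦ)
  obtain ⟨S, hS⟩ := exists_net hb hδ
  -- Baire
  have hbad : ∃ s : frontier D, ∃ ω : Set ℂ, IsOpen ω ∧ ω.Nonempty ∧ ω ⊆ D ∧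
      ∀ a ∈ ω, h₁ a + c₁ s = a * (h₀ a + c₀ s) := by
    have : BaireSpace D := hD.baireSpace
    have : Nonempty D := hne.to_subtype
    have k₀ : Continuous (fun a : D => h₀ a) :=
      continuousOn_iff_continuous_domRestrict.1 (hC₀.cont.mono subset_closure)
    have k₁ : Continuous (fun a : D => h₁ a) :=
      continuousOn_iff_continuous_domRestrict.1 (hC₁.cont.mono subset_closure)
    obtain ⟨s, hs⟩ := nonempty_interior_of_iUnion_of_closed (X := D) (ι := S)
      (f := fun s => {a : D | h₁ a + c₁ s.1 = a * (h₀ a + c₀ s.1)})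
      (fun s => isClosed_eq (k₁.add continuous_const)
        (continuous_subtype_val.mul (k₀.add continuous_const))) (by
        rw [eq_univ_iff_forall]
        intro a
        obtain ⟨s, hs, h⟩ := exists_bad hdeg hD hb hΦ hC₀ hC₁ S hS a.2
        exact mem_iUnion.2 ⟨⟨s, hs⟩, h⟩)
    refine ⟨s.1, Subtype.val '' interior {a : D | h₁ a + c₁ s.1 = a * (h₀ a + c₀ s.1)},
      hD.isOpenMap_subtype_val _ isOpen_interior, hs.image _, ?_, ?_⟩
    · rintro _ ⟨a, -, rfl⟩
      exact a.2
    · rintro _ ⟨a, ha, rfl⟩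
      exact (interior_subset ha : _)
  obtain ⟨s, ω, hω, ⟨z₀, hz₀⟩, hωD, hrel⟩ := hbad
  have hconj : ∀ z ∈ ω, Y₁ z = starRingEnd ℂ z * Y₀ z := by
    intro z hz
    obtain ⟨Z₀, A₀, hA₀, hv₀⟩ := hC₀.deriv z (hωD hz)
    obtain ⟨Z₁, A₁, hA₁, hv₁⟩ := hC₁.deriv z (hωD hz)
    have d₁ : HasFDerivAt (fun a => h₁ a + c₁ s) A₁ z := hA₁.add_const _
    have d₀ : HasFDerivAt (fun a => a * (h₀ a + c₀ s))
        (z • A₀ + (h₀ z + c₀ s) • ContinuousLinearMap.id ℝ ℂ) z :=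
      (hasFDerivAt_id z).mul (hA₀.add_const (c₀ s))
    have d₂ := d₀.congr_of_eventuallyEq (f₁ := fun a => h₁ a + c₁ s) (by
      filter_upwards [hω.mem_nhds hz] with a ha using hrel a ha)
    have hu := d₁.unique d₂
    have u1 := DFunLike.congr_fun hu 1
    have u2 := DFunLike.congr_fun hu Complex.I
    simp only [hv₁, hv₀, add_apply, smul_apply,
      ContinuousLinearMap.id_apply, smul_eq_mul, map_mul, Complex.conj_I, mul_one] at u1 u2
    have hI : Complex.I * Complex.I = -1 := Complex.I_mul_I
    have h3 : starRingEnd ℂ (Y₁ z) = z * starRingEnd ℂ (Y₀ z) := by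
      linear_combination (1 / 2) * u1 + (1 / 2) * Complex.I * u2 +
        (1 / 2) * (starRingEnd ℂ (Y₁ z) - z * starRingEnd ℂ (Y₀ z) - Z₁ + z * Z₀ + (h₀ z + c₀ s)) * hI
    have h4 := congrArg (starRingEnd ℂ) h3
    simpa using h4
  have hY₀ω := conj_relation hω (hC₀.hol.mono hωD) (hC₁.hol.mono hωD) hconj
  have hY₁ω : ∀ z ∈ ω, Y₁ z = 0 := fun z hz => by rw [hconj z hz, hY₀ω z hz, mul_zero]
  have hY₀ : ∀ z ∈ D, Y₀ z = 0 := fun z hz =>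
    (hC₀.hol.analyticOnNhd hD).eqOn_zero_of_preconnected_of_eventuallyEq_zero hcon (hωD hz₀)
      (by filter_upwards [hω.mem_nhds hz₀] with z hz using hY₀ω z hz) hz
  have hY₁ : ∀ z ∈ D, Y₁ z = 0 := fun z hz =>
    (hC₁.hol.analyticOnNhd hD).eqOn_zero_of_preconnected_of_eventuallyEq_zero hcon (hωD hz₀)
      (by filter_upwards [hω.mem_nhds hz₀] with z hz using hY₁ω z hz) hz
  have H₀ : DifferentiableOn ℂ (fun z => h₀ z + c₀ s) D := (hC₀.hol_of_zero hY₀).add_const _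
  have H₁ : DifferentiableOn ℂ (fun z => h₁ z + c₁ s) D := (hC₁.hol_of_zero hY₁).add_const _
  have H₂ : DifferentiableOn ℂ (fun z => z * (h₀ z + c₀ s)) D := differentiableOn_id.mul H₀
  have hEq : EqOn (fun z => h₁ z + c₁ s) (fun z => z * (h₀ z + c₀ s)) D :=
    (H₁.analyticOnNhd hD).eqOn_of_preconnected_of_eventuallyEq (H₂.analyticOnNhd hD) hcon
      (hωD hz₀) (by filter_upwards [hω.mem_nhds hz₀] with z hz using hrel z hz)
  have k₀ : ContinuousOn (fun z => h₀ z + c₀ s) (closure D) := hC₀.cont.add continuousOn_const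
  have hEq' : EqOn (fun z => h₁ z + c₁ s) (fun z => z * (h₀ z + c₀ s)) (closure D) :=
    hEq.of_subset_closure (hC₁.cont.add continuousOn_const) (continuousOn_id.mul k₀)
      subset_closure Subset.rfl
  have hκ : ∀ x : frontier D, c₁ x - c₁ s = x * (c₀ x - c₀ s) := by
    intro x
    have e₀ := hC₀.bd x
    have e₁ := hC₁.bd x
    have e₂ : h₁ x + c₁ s = x * (h₀ x + c₀ s) := hEq' (frontier_subset_closure x.2)
    linear_combination (x : ℂ) * e₀ - e₁ - e₂
  refine ⟨fun z => h₀ z + c₀ s, k₀, H₀, fun p hp => ?_⟩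
  obtain ⟨r, hr, hrp, hd⟩ := not_isolated hν hD hδ p hp
  have hκp := hκ ⟨p, hp⟩
  have hκr := hκ ⟨r, hr⟩
  have l₀ := hC₀.lc ⟨p, hp⟩ ⟨r, hr⟩ hd
  have l₁ := hC₁.lc ⟨p, hp⟩ ⟨r, hr⟩ hd
  rw [← l₀, ← l₁] at hκr
  have hz : (r - p) * (c₀ ⟨p, hp⟩ - c₀ s) = 0 := by
    simp only at hκp hκr
    linear_combination hκp - hκr
  have h5 : c₀ ⟨p, hp⟩ = c₀ s :=
    sub_eq_zero.1 ((mul_eq_zero.1 hz).resolve_left (sub_ne_zero.2 hrp))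
  have e₀ : Φ p = h₀ p + c₀ ⟨p, hp⟩ := hC₀.bd ⟨p, hp⟩
  rw [e₀, h5]

theorem backward_direction {𝒟 : BrouwerDegreeTheory ℂ} {D : Set ℂ} {Φ : ℂ → ℂ}
    (hD : IsOpen D) (hb : IsBounded D) (hC : HasCkBoundary 1 D)
    (hΦ : ContinuousOn Φ (frontier D)) (hdeg : DegHyp 𝒟 D Φ) : ExtendsHolomorphically Φ D := by
  obtain ⟨ν, hν⟩ := exists_normalField hD hb hC
  refine extends_of_comp hν hD (fun x₀ hx₀ => ?_)
  exact connected_case (hdeg.comp hν hD hb hΦ x₀) (hν.comp hD hb x₀) hD.connectedComponentIn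
    (hb.subset (connectedComponentIn_subset D x₀)) isPreconnected_connectedComponentIn
    ⟨x₀, mem_connectedComponentIn hx₀⟩ (hΦ.mono (hν.comp_frontier hD x₀))

end

/-- **Lemma 4.1.** Let `D ⊂ ℂ` be a bounded open set with `C¹` boundary. A continuous
function `Φ` on `bD` extends holomorphically through `D` if and only if for each function `G`
holomorphic in an open neighbourhood of the closure of `D` such that `Φ + G ≠ 0` on `bD`,
the Brouwer degree of `(Φ + G)|bD` is nonnegative. -/
theorem degree_and_holomorphic_extension_dim_one
    (D : Set ℂ) (hDopen : IsOpen D) (hDbdd : IsBounded D)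
    (hDbdry : HasCkBoundary 1 D)
    (𝒟 : BrouwerDegreeTheory ℂ)
    (Φ : ℂ → ℂ) (hΦ : ContinuousOn Φ (frontier D)) :
    ExtendsHolomorphically Φ D ↔
      ∀ (U : Set ℂ) (G : ℂ → ℂ),
        IsOpen U → closure D ⊆ U → DifferentiableOn ℂ G U →
        (∀ z ∈ frontier D, Φ z + G z ≠ 0) →
        ∀ F : ℂ → ℂ,
          ContinuousOn F (closure D) →
          (∀ z ∈ frontier D, F z = Φ z + G z) →
          0 ≤ 𝒟.deg F D 0 := by
  constructor
  · intro h U G _ hDU hG hn F hF hFe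
    exact forward_direction D hDopen hDbdd 𝒟 Φ h U G hDU hG hn F hF hFe
  · intro h
    exact backward_direction (𝒟 := 𝒟) hDopen hDbdd hDbdry hΦ h

end
end

section
/- Let A : ℂ^N → ℂ^N be an ℝ-linear map such that for every ℂ-linear map B : ℂ^N → ℂ^N for which A + B is invertible, the map A + B preserves orientation (i.e., has positive determinant when regarded as an ℝ-linear map of ℝ^{2N}). Then A is ℂ-linear. -/
noncomputable section

/-- Weinstein–Aronszajn identity for linear maps. -/
lemma aux_det_one_add_comm {V W : Type*} [AddCommGroup V] [Module ℝ V] [FiniteDimensional ℝ V]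
    [AddCommGroup W] [Module ℝ W] [FiniteDimensional ℝ W] (X : W →ₗ[ℝ] V) (Y : V →ₗ[ℝ] W) :
    LinearMap.det (LinearMap.id + X ∘ₗ Y) = LinearMap.det (LinearMap.id + Y ∘ₗ X) := by
  classical
  let b := Module.finBasis ℝ V
  let c := Module.finBasis ℝ W
  rw [← LinearMap.det_toMatrix b, ← LinearMap.det_toMatrix c, map_add, map_add,
    LinearMap.toMatrix_id, LinearMap.toMatrix_id, LinearMap.toMatrix_comp b c b,
    LinearMap.toMatrix_comp c b c, Matrix.det_one_add_mul_comm]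

lemma aux_det_complex (f : ℂ →ₗ[ℝ] ℂ) :
    LinearMap.det f = (f 1).re * (f Complex.I).im - (f Complex.I).re * (f 1).im := by
  rw [← LinearMap.det_toMatrix Complex.basisOneI, Matrix.det_fin_two]
  simp [LinearMap.toMatrix_apply]

/-- Choice of the functional. -/
lemma aux_functional {E : Type*} [AddCommGroup E] [Module ℂ E] (p q : E) (hp : p ≠ 0)
    (hq : q ≠ Complex.I • p) :
    ∃ φ : E →ₗ[ℂ] ℂ,
      (1 + φ p).re * (Complex.I + φ q).im - (Complex.I + φ q).re * (1 + φ p).im < 0 := by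
  by_cases h : q ∈ Submodule.span ℂ {p}
  · obtain ⟨c, rfl⟩ := Submodule.mem_span_singleton.1 h
    have hc : c ≠ Complex.I := fun h => hq (by rw [h])
    obtain ⟨φ, hφ⟩ := Module.Projective.exists_dual_eq_one ℂ hp
    set d : ℝ := 1 / (1 + |c.im|) with hd
    have hd0 : 0 < d := by positivity
    have hd1 : d * c.im < 1 := by
      rw [hd, div_mul_eq_mul_div, one_mul, div_lt_one (by positivity)]
      linarith [le_abs_self c.im]
    have hpos : 0 < c.re ^ 2 + (1 - c.im) ^ 2 := by
      by_contra hn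
      apply hc
      have h1 : c.re = 0 := by nlinarith [sq_nonneg c.re, sq_nonneg (1 - c.im)]
      have h2 : 1 - c.im = 0 := by nlinarith [sq_nonneg c.re, sq_nonneg (1 - c.im)]
      apply Complex.ext <;> simp <;> linarith
    refine ⟨(-1 + Complex.I * d * (Complex.I - c)) • φ, ?_⟩
    have key : 0 < d * (1 - d * c.im) * (c.re ^ 2 + (1 - c.im) ^ 2) := by
      have : 0 < 1 - d * c.im := by linarith
      positivity
    simp [hφ]
    nlinarith [key]
  · obtain ⟨φ, hφ, hker⟩ := Submodule.exists_le_ker_of_notMem h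
    have hφp : φ p = 0 := hker (Submodule.mem_span_singleton_self p)
    refine ⟨(-2 * Complex.I / φ q) • φ, ?_⟩
    simp [hφp, hφ]

/-- **Proposition 5.3.** Let `A : ℂ^N → ℂ^N` be an `ℝ`-linear map such that `A + B`
preserves orientation (has positive determinant as an `ℝ`-linear map of `ℝ^{2N}`)
whenever `B : ℂ^N → ℂ^N` is a `ℂ`-linear map such that `A + B` is invertible.
Then `A` is `ℂ`-linear. -/
theorem complex_linear_of_orientation_preserving
    (N : ℕ)
    (A : EuclideanSpace ℂ (Fin N) →ₗ[ℝ] EuclideanSpace ℂ (Fin N))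
    (hA : ∀ B : EuclideanSpace ℂ (Fin N) →ₗ[ℂ] EuclideanSpace ℂ (Fin N),
      Function.Bijective ⇑(A + B.restrictScalars ℝ) →
      0 < LinearMap.det (A + B.restrictScalars ℝ)) :
    ∀ (c : ℂ) (x : EuclideanSpace ℂ (Fin N)), A (c • x) = c • A x := by
  have hfin : FiniteDimensional ℝ (EuclideanSpace ℂ (Fin N)) :=
    FiniteDimensional.trans ℝ ℂ _
  have main : ∀ x, A (Complex.I • x) = Complex.I • A x := by
    by_contra! hx
    obtain ⟨x, hx⟩ := hx
    -- an invertible translate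
    obtain ⟨t, ht⟩ := (Module.End.finite_spectrum A).infinite_compl.nonempty
    have hu : IsUnit (algebraMap ℝ (Module.End ℝ (EuclideanSpace ℂ (Fin N))) t - A) :=
      spectrum.notMem_iff.1 ht
    let B : EuclideanSpace ℂ (Fin N) →ₗ[ℂ] EuclideanSpace ℂ (Fin N) :=
      (-(t : ℂ)) • LinearMap.id
    have hBT : A + B.restrictScalars ℝ =
        -(algebraMap ℝ (Module.End ℝ (EuclideanSpace ℂ (Fin N))) t - A) := by
      ext1 y
      simp [B, sub_eq_add_neg, Module.algebraMap_end_apply]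
    have hbij : Function.Bijective ⇑(A + B.restrictScalars ℝ) := by
      rw [hBT]
      exact (Module.End.isUnit_iff _).1 hu.neg
    have hdet := hA B hbij
    set T := A + B.restrictScalars ℝ with hT
    let e := LinearEquiv.ofBijective T hbij
    have he : ∀ y, T (e.symm y) = y := fun y => e.apply_symm_apply y
    have he' : ∀ y, e.symm (T y) = y := fun y => e.symm_apply_apply y
    have hp : x ≠ 0 := by
      rintro rfl
      simp at hx
    have hq : e.symm (Complex.I • T x) ≠ Complex.I • x := by
      intro h
      have h2 := congrArg T h
      rw [he] at h2
      apply hx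
      simp only [hT, LinearMap.add_apply, LinearMap.restrictScalars_apply, map_smul,
        smul_add] at h2
      exact (add_right_cancel h2).symm
    obtain ⟨φ, hφ⟩ := aux_functional x _ hp hq
    let U : ℂ →ₗ[ℝ] EuclideanSpace ℂ (Fin N) :=
      (LinearMap.toSpanSingleton ℂ _ (T x)).restrictScalars ℝ
    let X : ℂ →ₗ[ℝ] EuclideanSpace ℂ (Fin N) := e.symm.toLinearMap ∘ₗ U
    let Y : EuclideanSpace ℂ (Fin N) →ₗ[ℝ] ℂ := φ.restrictScalars ℝ
    have hfac : A + (B + φ.smulRight (T x)).restrictScalars ℝ =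
        T ∘ₗ (LinearMap.id + X ∘ₗ Y) := by
      ext1 y
      simp only [LinearMap.comp_apply, LinearMap.add_apply, LinearMap.id_apply, map_add, X, Y, U,
        LinearEquiv.coe_coe, he]
      simp [hT, add_assoc]
    have hneg : LinearMap.det (A + (B + φ.smulRight (T x)).restrictScalars ℝ) < 0 := by
      rw [hfac, LinearMap.det_comp, aux_det_one_add_comm, aux_det_complex]
      refine mul_neg_of_pos_of_neg hdet ?_
      have h1 : (LinearMap.id + Y ∘ₗ X : ℂ →ₗ[ℝ] ℂ) 1 = 1 + φ x := by
        simp [X, Y, U, he']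
      have h2 : (LinearMap.id + Y ∘ₗ X : ℂ →ₗ[ℝ] ℂ) Complex.I
          = Complex.I + φ (e.symm (Complex.I • T x)) := by
        simp [X, Y, U]
      rw [h1, h2]
      exact hφ
    refine lt_asymm hneg (hA _ ?_)
    rw [← Module.End.isUnit_iff, LinearMap.isUnit_iff_isUnit_det]
    exact hneg.ne.isUnit
  intro c x
  have hc : ∀ y : EuclideanSpace ℂ (Fin N), c • y = c.re • y + c.im • (Complex.I • y) := by
    intro y
    conv_lhs => rw [← Complex.re_add_im c]
    rw [add_smul, mul_smul, Complex.coe_smul, Complex.coe_smul]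
  rw [hc, hc, map_add, map_smul, map_smul, main]

end
end
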